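/- arXiv:2105.09769 — 4 statements merged into one kernel-verified Lean document; each statement's English description precedes it below -/
import Mathlib

section
/- Let γ : (−ε, ε) → ℝⁿ be a real analytic map with γ(0) = 0 that is not identically zero and is a homeomorphism onto its image Γ := γ((−ε, ε)), and write γ(t) = t^k·α(t) with α real analytic and w := α(0) ≠ 0. Then the tangent cone of Γ at 0 equals the line {t·w : t ∈ ℝ} if k is odd, and equals the half-line {t·w : t ≥ 0} if k is even. Consequently, the tangent cone of Γ at 0 is homeomorphic to ℝ if and only if k is odd. -/
open Filter Set Topology

/-- The tangent cone at `0` of a set `X`: vectors `v` for which there are points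
`xᵢ ∈ X \ {0}` tending to `0` and positive reals `tᵢ` with `(1/tᵢ) • xᵢ → v`. -/
def tangentConeAtZero {E : Type*} [NormedAddCommGroup E] [NormedSpace ℝ E]
    (X : Set E) : Set E :=
  {v | ∃ (x : ℕ → E) (t : ℕ → ℝ), (∀ i, x i ∈ X \ {0}) ∧
    Tendsto x atTop (𝓝 0) ∧ (∀ i, 0 < t i) ∧
    Tendsto (fun i => (t i)⁻¹ • x i) atTop (𝓝 v)}

lemma cone_aux {n : ℕ} (ε : ℝ) (hε : 0 < ε)
    (γ α : ℝ → EuclideanSpace ℝ (Fin n)) (k : ℕ)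
    (hγ0 : γ 0 = 0)
    (hinj : Set.InjOn γ (Set.Ioo (-ε) ε))
    (hα : ContinuousAt α 0)
    (hfac : ∀ t ∈ Set.Ioo (-ε) ε, γ t = t ^ k • α t)
    (σ c : ℝ) (hσ : σ = 1 ∨ σ = -1) (hc : 0 ≤ c) :
    (c * σ ^ k) • α 0 ∈ tangentConeAtZero (γ '' Set.Ioo (-ε) ε) := by
  have habs : |σ| = 1 := by rcases hσ with h | h <;> simp [h]
  have hlim : Tendsto (fun i : ℕ => (1 : ℝ) / ((i : ℝ) + 1)) atTop (𝓝 0) :=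
    tendsto_one_div_add_atTop_nhds_zero_nat
  let r : ℕ → ℝ := fun i => (ε / 2) * (1 / ((i : ℝ) + 1))
  have hr0 : ∀ i, 0 < r i := fun i => by positivity
  have hr1 : ∀ i, r i < ε := fun i => by
    have : (1 : ℝ) / ((i : ℝ) + 1) ≤ 1 := by
      rw [div_le_one (by positivity)]
      have : (0 : ℝ) ≤ i := Nat.cast_nonneg i
      linarith
    have h2 : r i ≤ (ε / 2) * 1 := mul_le_mul_of_nonneg_left this (by positivity)
    linarith
  have hrl : Tendsto r atTop (𝓝 0) := by
    have h := hlim.const_mul (ε / 2)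
    rw [mul_zero] at h
    exact h
  have hs : Tendsto (fun i => σ * r i) atTop (𝓝 0) := by
    simpa using hrl.const_mul σ
  have hmem : ∀ i, σ * r i ∈ Set.Ioo (-ε) ε := fun i => by
    have := hr0 i
    have := hr1 i
    rcases hσ with h | h <;> subst h <;> constructor <;> linarith
  have hσ0 : σ ≠ 0 := by rcases hσ with h | h <;> simp [h]
  have hαs : Tendsto (fun i => α (σ * r i)) atTop (𝓝 (α 0)) := hα.tendsto.comp hs
  have hck : ∀ i : ℕ, 0 < c + 1 / ((i : ℝ) + 1) := fun i => by positivity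
  have hcl : Tendsto (fun i : ℕ => c + 1 / ((i : ℝ) + 1)) atTop (𝓝 c) := by
    simpa using hlim.const_add c
  have h0mem : (0 : ℝ) ∈ Set.Ioo (-ε) ε := ⟨by linarith, hε⟩
  refine ⟨fun i => γ (σ * r i), fun i => r i ^ k / (c + 1 / ((i : ℝ) + 1)), ?_, ?_, ?_, ?_⟩
  · intro i
    refine ⟨⟨_, hmem i, rfl⟩, ?_⟩
    intro h
    have h' : γ (σ * r i) = γ 0 := by rw [hγ0]; exact h
    have := hinj (hmem i) h0mem h'
    exact mul_ne_zero hσ0 (hr0 i).ne' this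
  · have h1 : Tendsto (fun i => (σ * r i) ^ k • α (σ * r i)) atTop (𝓝 ((0 : ℝ) ^ k • α 0)) :=
      (hs.pow k).smul hαs
    have h2 := hfac 0 h0mem
    rw [hγ0] at h2
    rw [← h2] at h1
    exact h1.congr fun i => (hfac _ (hmem i)).symm
  · intro i
    exact div_pos (pow_pos (hr0 i) k) (hck i)
  · refine ((hcl.mul_const (σ ^ k)).smul hαs).congr fun i => ?_
    beta_reduce
    rw [hfac _ (hmem i), smul_smul]
    congr 1
    have := (pow_pos (hr0 i) k).ne'
    have := (hck i).ne'
    rw [mul_pow σ, inv_div, div_mul_eq_mul_div, eq_div_iff (pow_pos (hr0 i) k).ne']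
    ring

lemma cone_sub {n : ℕ} (ε : ℝ) (hε : 0 < ε)
    (γ α : ℝ → EuclideanSpace ℝ (Fin n)) (k : ℕ)
    (hγ0 : γ 0 = 0)
    (hhomeo : ∃ δ : EuclideanSpace ℝ (Fin n) → ℝ,
      ContinuousOn δ (γ '' Set.Ioo (-ε) ε) ∧ ∀ t ∈ Set.Ioo (-ε) ε, δ (γ t) = t)
    (hα : ContinuousAt α 0) (hw0 : α 0 ≠ 0)
    (hfac : ∀ t ∈ Set.Ioo (-ε) ε, γ t = t ^ k • α t)
    (v : EuclideanSpace ℝ (Fin n)) (hv : v ∈ tangentConeAtZero (γ '' Set.Ioo (-ε) ε)) :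
    ∃ c : ℝ, v = c • α 0 ∧ (Even k → 0 ≤ c) := by
  obtain ⟨δ, hδ, hδγ⟩ := hhomeo
  obtain ⟨x, t, hx, hxl, ht, hl⟩ := hv
  have h0mem : (0 : ℝ) ∈ Set.Ioo (-ε) ε := ⟨by linarith, hε⟩
  choose s hs hsx using fun i => (hx i).1
  have hsl : Tendsto s atTop (𝓝 0) := by
    have h0 : (0 : EuclideanSpace ℝ (Fin n)) ∈ γ '' Set.Ioo (-ε) ε := ⟨0, h0mem, hγ0⟩
    have h1 := hδ 0 h0
    have h2 : Tendsto x atTop (𝓝[γ '' Set.Ioo (-ε) ε] 0) :=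
      tendsto_nhdsWithin_iff.2 ⟨hxl, Eventually.of_forall fun i => (hx i).1⟩
    have h3 := h1.tendsto.comp h2
    have h4 : δ 0 = 0 := by have := hδγ 0 h0mem; rwa [hγ0] at this
    rw [h4] at h3
    refine h3.congr fun i => ?_
    simp only [Function.comp_apply]
    rw [← hsx i, hδγ _ (hs i)]
  have hαs : Tendsto (fun i => α (s i)) atTop (𝓝 (α 0)) := hα.tendsto.comp hsl
  have hl2 : Tendsto (fun i => ((t i)⁻¹ * s i ^ k) • α (s i)) atTop (𝓝 v) := by
    refine hl.congr fun i => ?_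
    rw [← hsx i, hfac _ (hs i), smul_smul]
  have hin : Tendsto (fun i => inner ℝ (α (s i)) (α 0)) atTop (𝓝 (inner ℝ (α 0) (α 0))) :=
    hαs.inner tendsto_const_nhds
  have hne : inner ℝ (α 0) (α 0) ≠ (0 : ℝ) := inner_self_ne_zero.2 hw0
  have hin2 : Tendsto (fun i => inner ℝ (((t i)⁻¹ * s i ^ k) • α (s i)) (α 0)) atTop
      (𝓝 (inner ℝ v (α 0))) := hl2.inner tendsto_const_nhds
  have hcl : Tendsto (fun i => (t i)⁻¹ * s i ^ k) atTop
      (𝓝 (inner ℝ v (α 0) / inner ℝ (α 0) (α 0))) := by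
    refine (hin2.div hin hne).congr' ?_
    filter_upwards [hin.eventually_ne hne] with i hi
    simp only [Pi.div_apply]
    rw [real_inner_smul_left, mul_div_assoc, div_self hi, mul_one]
  refine ⟨_, tendsto_nhds_unique hl2 (hcl.smul hαs), fun hk => ?_⟩
  exact ge_of_tendsto' hcl fun i => mul_nonneg (inv_nonneg.2 (ht i).le) (hk.pow_nonneg _)

lemma not_homeo {E : Type*} [NormedAddCommGroup E] [InnerProductSpace ℝ E] (w : E) (hw : w ≠ 0)
    (e : ↥((fun t : ℝ => t • w) '' Set.Ici 0) ≃ₜ ℝ) : False := by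
  have hpos : (0 : ℝ) < inner ℝ w w := real_inner_self_pos.2 hw
  let g : ℝ → ℝ := fun x => inner ℝ (e.symm x : E) w
  have hg : Continuous g :=
    (continuous_subtype_val.comp e.symm.continuous).inner continuous_const
  have hnn : ∀ x, 0 ≤ g x := fun x => by
    obtain ⟨c, hc, h⟩ := (e.symm x).2
    have h' : c • w = (e.symm x : E) := h
    change 0 ≤ inner ℝ (e.symm x : E) w
    rw [← h', real_inner_smul_left]
    exact mul_nonneg hc hpos.le
  have hinj : Function.Injective g := fun x y hxy => by
    obtain ⟨c, hc, h⟩ := (e.symm x).2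
    obtain ⟨d, hd, h2⟩ := (e.symm y).2
    have h' : c • w = (e.symm x : E) := h
    have h2' : d • w = (e.symm y : E) := h2
    change inner ℝ (e.symm x : E) w = inner ℝ (e.symm y : E) w at hxy
    rw [← h', ← h2', real_inner_smul_left, real_inner_smul_left] at hxy
    have hcd := mul_right_cancel₀ hpos.ne' hxy
    apply e.symm.injective
    apply Subtype.ext
    rw [← h', ← h2', hcd]
  let p := e ⟨0, 0, Set.mem_Ici.2 le_rfl, zero_smul ℝ w⟩
  have hp : g p = 0 := by simp [g, p]
  rcases hg.strictMono_of_inj hinj with h | h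
  · have := h (show p - 1 < p by linarith)
    linarith [hnn (p - 1)]
  · have := h (show p < p + 1 by linarith)
    linarith [hnn (p + 1)]

/-- For a real analytic curve germ `γ(t) = t^k • α(t)`, `α(0) = w ≠ 0`,
which is a homeomorphism onto its image `Γ`, the tangent cone of `Γ` at `0` is the
line `{t • w : t ∈ ℝ}` if `k` is odd and the half-line `{t • w : t ≥ 0}` if `k` is
even; consequently it is homeomorphic to `ℝ` iff `k` is odd. -/
theorem stmt1 {n : ℕ} (ε : ℝ) (hε : 0 < ε)
    (γ α : ℝ → EuclideanSpace ℝ (Fin n)) (k : ℕ) (hk : 1 ≤ k)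
    (hγan : AnalyticOnNhd ℝ γ (Set.Ioo (-ε) ε))
    (hγ0 : γ 0 = 0)
    (hγne : ¬ ∀ t ∈ Set.Ioo (-ε) ε, γ t = 0)
    (hinj : Set.InjOn γ (Set.Ioo (-ε) ε))
    (hhomeo : ∃ δ : EuclideanSpace ℝ (Fin n) → ℝ,
      ContinuousOn δ (γ '' Set.Ioo (-ε) ε) ∧ ∀ t ∈ Set.Ioo (-ε) ε, δ (γ t) = t)
    (hαan : AnalyticOnNhd ℝ α (Set.Ioo (-ε) ε))
    (w : EuclideanSpace ℝ (Fin n)) (hw : w = α 0) (hw0 : w ≠ 0)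
    (hfac : ∀ t ∈ Set.Ioo (-ε) ε, γ t = t ^ k • α t) :
    (Odd k → tangentConeAtZero (γ '' Set.Ioo (-ε) ε) = Set.range (fun t : ℝ => t • w)) ∧
    (Even k → tangentConeAtZero (γ '' Set.Ioo (-ε) ε) = (fun t : ℝ => t • w) '' Set.Ici 0) ∧
    (Nonempty (↥(tangentConeAtZero (γ '' Set.Ioo (-ε) ε)) ≃ₜ ℝ) ↔ Odd k) := by
  subst hw
  have hα : ContinuousAt α 0 := (hαan 0 ⟨by linarith, hε⟩).continuousAt
  have hsub := cone_sub ε hε γ α k hγ0 hhomeo hα hw0 hfac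
  have haux := cone_aux ε hε γ α k hγ0 hinj hα hfac
  have hodd : Odd k → tangentConeAtZero (γ '' Set.Ioo (-ε) ε)
      = Set.range (fun t : ℝ => t • α 0) := by
    intro hk
    ext v
    constructor
    · intro hv
      obtain ⟨c, h, -⟩ := hsub v hv
      exact ⟨c, h.symm⟩
    · rintro ⟨c, rfl⟩
      rcases le_total 0 c with hc | hc
      · simpa using haux 1 c (Or.inl rfl) hc
      · simpa [hk.neg_one_pow] using haux (-1) (-c) (Or.inr rfl) (by linarith)
  have heven : Even k → tangentConeAtZero (γ '' Set.Ioo (-ε) ε)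
      = (fun t : ℝ => t • α 0) '' Set.Ici 0 := by
    intro hk
    ext v
    constructor
    · intro hv
      obtain ⟨c, h, h2⟩ := hsub v hv
      exact ⟨c, h2 hk, h.symm⟩
    · rintro ⟨c, hc, rfl⟩
      simpa using haux 1 c (Or.inl rfl) hc
  refine ⟨hodd, heven, ?_, ?_⟩
  · rintro ⟨e⟩
    by_contra hk
    rw [Nat.not_odd_iff_even] at hk
    rw [heven hk] at e
    exact not_homeo _ hw0 e
  · intro hk
    rw [hodd hk]
    exact ⟨(isClosedEmbedding_smul_left hw0).isEmbedding.toHomeomorph.symm⟩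
end

section
/- Let γ : (−ε, ε) → ℝⁿ be a real analytic map with γ(0) = 0 that is not identically zero and is a homeomorphism onto its image Γ := γ((−ε, ε)), and write γ(t) = t^k·α(t) with α real analytic and α(0) ≠ 0. If k is odd, then the map β(s) := γ(s^{1/k}) = s·α(s^{1/k}) (where s^{1/k} denotes the real odd k-th root) is a C¹ map on (−ε^k, ε^k) with β(0) = 0 and β′(0) = α(0) ≠ 0, and β is a homeomorphism onto Γ; consequently Γ is C¹ regular at 0. -/
open Filter Set Topology

/-- The real odd `k`-th root: `oddRoot k s = sign(s) * |s|^(1/k)`. For odd `k` this is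
the inverse of `t ↦ t^k`. -/
noncomputable def oddRoot (k : ℕ) (s : ℝ) : ℝ := Real.sign s * |s| ^ ((1 : ℝ) / k)

/-- `S` is a `C¹` submanifold of `ℝⁿ` of dimension `d`: every point of `S` admits an
open neighborhood `W` and a `C¹` diffeomorphism `Φ` from `W` onto an open set with
`Φ '' (S ∩ W) = Φ '' W ∩ (ℝ^d × {0})`. -/
def IsC1SubmanifoldOfDim {n : ℕ} (S : Set (EuclideanSpace ℝ (Fin n))) (d : ℕ) : Prop :=
  ∀ p ∈ S, ∃ (W : Set (EuclideanSpace ℝ (Fin n)))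
      (Φ : EuclideanSpace ℝ (Fin n) → EuclideanSpace ℝ (Fin n)),
    IsOpen W ∧ p ∈ W ∧ IsOpen (Φ '' W) ∧ ContDiffOn ℝ 1 Φ W ∧
    (∃ Ψ, Set.InvOn Ψ Φ W (Φ '' W) ∧ ContDiffOn ℝ 1 Ψ (Φ '' W)) ∧
    Φ '' (S ∩ W) = (Φ '' W) ∩ {x | ∀ i : Fin n, d ≤ (i : ℕ) → x i = 0}

/-- `X ⊆ ℝⁿ` is `C¹` regular at `0`: some open neighborhood `U` of `0` is such that
`X ∩ U` is a `C¹` submanifold of `ℝⁿ`. -/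
def IsC1RegularAtZero {n : ℕ} (X : Set (EuclideanSpace ℝ (Fin n))) : Prop :=
  ∃ U : Set (EuclideanSpace ℝ (Fin n)), IsOpen U ∧ 0 ∈ U ∧
    ∃ d : ℕ, IsC1SubmanifoldOfDim (X ∩ U) d

theorem regular_aux {n : ℕ} (I : Set ℝ) (hI : IsOpen I) (h0 : (0 : ℝ) ∈ I)
    (β : ℝ → EuclideanSpace ℝ (Fin n)) (hβ : ContDiffOn ℝ 1 β I) (hβ0 : β 0 = 0)
    (v : EuclideanSpace ℝ (Fin n)) (hv : v ≠ 0) (hd : HasDerivAt β v 0)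
    (δ : EuclideanSpace ℝ (Fin n) → ℝ) (hδ : ContinuousOn δ (β '' I))
    (hδβ : ∀ s ∈ I, δ (β s) = s) : IsC1RegularAtZero (β '' I) := by
  rcases n with _ | m
  · exact absurd (Subsingleton.elim v 0) hv
  set e0 : EuclideanSpace ℝ (Fin (m + 1)) := EuclideanSpace.single 0 1 with he0
  have he0ne : e0 ≠ 0 := by
    intro h
    have := congrArg (fun x : EuclideanSpace ℝ (Fin (m + 1)) => x 0) h
    simp [he0] at this
  obtain ⟨L, hL⟩ := SeparatingDual.exists_continuousLinearEquiv_apply_eq (R := ℝ) he0ne hv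
  set pr : EuclideanSpace ℝ (Fin (m + 1)) →L[ℝ] ℝ := EuclideanSpace.proj 0 with hpr
  have hpra : ∀ x, pr x = x 0 := fun x => rfl
  have hpre : ∀ s : ℝ, pr (s • e0) = s := by intro s; rw [hpra]; simp [he0]
  set G : EuclideanSpace ℝ (Fin (m + 1)) → EuclideanSpace ℝ (Fin (m + 1)) :=
    fun x => β (pr x) + (L x - pr x • v) with hG
  have hGs : ∀ s : ℝ, G (s • e0) = β s := by
    intro s
    simp only [hG, hpre, map_smul, hL, sub_self, add_zero]
  have hG0 : G 0 = 0 := by simp [hG, hβ0]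
  have hGat : ∀ x, pr x ∈ I → ContDiffAt ℝ 1 G x := by
    intro x hx
    have h1 : ContDiffAt ℝ 1 (fun x => β (pr x)) x :=
      ContDiffAt.comp x (hβ.contDiffAt (hI.mem_nhds hx)) pr.contDiff.contDiffAt
    exact h1.add (L.contDiff.contDiffAt.sub (pr.contDiff.contDiffAt.smul contDiffAt_const))
  have hGd : HasFDerivAt G (L : EuclideanSpace ℝ (Fin (m + 1)) →L[ℝ] _) 0 := by
    have h1 : HasFDerivAt (fun x => β (pr x))
        ((ContinuousLinearMap.toSpanSingleton ℝ v).comp pr) 0 := by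
      have hd' : HasFDerivAt β (ContinuousLinearMap.toSpanSingleton ℝ v) (pr 0) := by
        rw [map_zero]; exact hd.hasFDerivAt
      exact hd'.comp 0 pr.hasFDerivAt
    have h2 : HasFDerivAt (fun x => pr x • v)
        ((ContinuousLinearMap.toSpanSingleton ℝ v).comp pr) 0 :=
      ((ContinuousLinearMap.toSpanSingleton ℝ v).comp pr).hasFDerivAt
    have h3 := h1.add ((L : EuclideanSpace ℝ (Fin (m + 1)) →L[ℝ] _).hasFDerivAt.sub h2)
    refine h3.congr_fderiv ?_
    abel
  have hGc : ContDiffAt ℝ 1 G 0 := hGat 0 (by simpa using h0)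
  set e := hGc.toOpenPartialHomeomorph G hGd one_ne_zero with he
  have heG : ∀ x, e x = G x := fun x => rfl
  have hs0 : (0 : EuclideanSpace ℝ (Fin (m + 1))) ∈ e.source :=
    hGc.mem_toOpenPartialHomeomorph_source hGd one_ne_zero
  have ht0 : (0 : EuclideanSpace ℝ (Fin (m + 1))) ∈ e.target := by
    have := e.map_source hs0
    rwa [heG, hG0] at this
  have hes0 : e.symm 0 = 0 := by
    have := e.left_inv hs0
    rwa [heG, hG0] at this
  have hsymm : ContDiffAt ℝ 1 e.symm 0 := by
    have := hGc.to_localInverse hGd one_ne_zero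
    rw [hG0] at this
    exact this
  have hev1 : ∀ᶠ y in 𝓝 (0 : EuclideanSpace ℝ (Fin (m + 1))), ContDiffAt ℝ 1 e.symm y :=
    hsymm.eventually (by simp)
  have hev2 : ∀ᶠ y in 𝓝 (0 : EuclideanSpace ℝ (Fin (m + 1))), pr (e.symm y) ∈ I := by
    have hc : ContinuousAt (fun y => pr (e.symm y)) 0 :=
      pr.continuous.continuousAt.comp hsymm.continuousAt
    apply hc
    apply hI.mem_nhds
    simpa [hes0] using h0
  have hev3 : ∀ᶠ y in 𝓝 (0 : EuclideanSpace ℝ (Fin (m + 1))),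
      y ∈ β '' I → δ y • e0 ∈ e.source := by
    rw [← eventually_nhdsWithin_iff]
    have h0m : (0 : EuclideanSpace ℝ (Fin (m + 1))) ∈ β '' I := ⟨0, h0, hβ0⟩
    have hδ0 : δ 0 = 0 := by have := hδβ 0 h0; rwa [hβ0] at this
    have hc : ContinuousWithinAt (fun y => δ y • e0) (β '' I) 0 :=
      (hδ 0 h0m).smul continuousWithinAt_const
    apply hc
    apply e.open_source.mem_nhds
    simpa [hδ0] using hs0
  obtain ⟨U, hU, hUo, hU0⟩ := eventually_nhds_iff.1
    (hev1.and (hev2.and (hev3.and (e.open_target.eventually_mem ht0))))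
  have hUt : U ⊆ e.target := fun y hy => (hU y hy).2.2.2
  refine ⟨U, hUo, hU0, 1, ?_⟩
  intro p hp
  refine ⟨U, e.symm, hUo, hp.2, ?_, ?_, ⟨G, ⟨?_, ?_⟩, ?_⟩, ?_⟩
  · exact e.symm.isOpen_image_of_subset_source hUo hUt
  · exact fun y hy => (hU y hy).1.contDiffWithinAt
  · intro y hy
    exact e.right_inv (hUt hy)
  · rintro _ ⟨y, hy, rfl⟩
    exact congrArg e.symm (e.right_inv (hUt hy))
  · rintro _ ⟨y, hy, rfl⟩
    exact (hGat _ (hU y hy).2.1).contDiffWithinAt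
  · ext x
    constructor
    · rintro ⟨y, ⟨⟨hyI, hyU'⟩, hyU⟩, rfl⟩
      refine ⟨⟨y, hyU, rfl⟩, ?_⟩
      have h3 := (hU y hyU).2.2.1 hyI
      obtain ⟨s, hs, rfl⟩ := hyI
      rw [hδβ s hs] at h3
      have h4 : e.symm (β s) = s • e0 := by
        rw [← hGs s, ← heG]; exact e.left_inv h3
      intro i hi
      rw [h4]
      have : i ≠ 0 := by rintro rfl; simp at hi
      simp [he0, this]
    · rintro ⟨⟨y, hyU, rfl⟩, hx⟩
      refine ⟨y, ⟨⟨?_, hyU⟩, hyU⟩, rfl⟩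
      refine ⟨pr (e.symm y), (hU y hyU).2.1, ?_⟩
      have h5 : e.symm y = pr (e.symm y) • e0 := by
        ext i
        by_cases hi : i = 0
        · subst hi; rw [hpra]; simp [he0]
        · have : 1 ≤ (i : ℕ) := Nat.one_le_iff_ne_zero.2 (fun h => hi (Fin.ext h))
          rw [hx i this]; simp [he0, hi]
      rw [← hGs, ← h5, ← heG]
      exact e.right_inv (hUt hyU)

theorem oddRoot_pow {k : ℕ} (hodd : Odd k) (s : ℝ) : (oddRoot k s) ^ k = s := by
  have hk : k ≠ 0 := by rintro rfl; simp at hodd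
  unfold oddRoot
  rw [mul_pow, one_div, Real.rpow_inv_natCast_pow (abs_nonneg s) hk]
  rcases lt_trichotomy s 0 with h | h | h
  · rw [Real.sign_of_neg h, hodd.neg_one_pow, abs_of_neg h]; ring
  · simp [h]
  · rw [Real.sign_of_pos h, one_pow, abs_of_pos h]; ring

theorem pow_oddRoot {k : ℕ} (hodd : Odd k) (t : ℝ) : oddRoot k (t ^ k) = t :=
  hodd.strictMono_pow.injective (oddRoot_pow hodd _)

theorem oddRoot_strictMono {k : ℕ} (hodd : Odd k) : StrictMono (oddRoot k) := by
  intro a b hab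
  apply (hodd.strictMono_pow (R := ℝ)).lt_iff_lt.1
  simpa only [oddRoot_pow hodd] using hab

theorem oddRoot_continuous {k : ℕ} (hodd : Odd k) : Continuous (oddRoot k) :=
  (oddRoot_strictMono hodd).monotone.continuous_of_surjective
    (fun t => ⟨t ^ k, pow_oddRoot hodd t⟩)

theorem oddRoot_zero' {k : ℕ} : oddRoot k 0 = 0 := by simp [oddRoot]

theorem oddRoot_mem {k : ℕ} (hodd : Odd k) {ε s : ℝ} (hs : s ∈ Set.Ioo (-(ε ^ k)) (ε ^ k)) :
    oddRoot k s ∈ Set.Ioo (-ε) ε := by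
  constructor
  · apply (hodd.strictMono_pow (R := ℝ)).lt_iff_lt.1
    simpa only [oddRoot_pow hodd, hodd.neg_pow] using hs.1
  · apply (hodd.strictMono_pow (R := ℝ)).lt_iff_lt.1
    simpa only [oddRoot_pow hodd] using hs.2

theorem pow_mem_aux {k : ℕ} (hodd : Odd k) {ε t : ℝ} (ht : t ∈ Set.Ioo (-ε) ε) :
    t ^ k ∈ Set.Ioo (-(ε ^ k)) (ε ^ k) := by
  constructor
  · rw [← hodd.neg_pow]; exact hodd.strictMono_pow ht.1
  · exact hodd.strictMono_pow ht.2

theorem beta_deriv {n k : ℕ} (hodd : Odd k) {ε : ℝ}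
    (α : ℝ → EuclideanSpace ℝ (Fin n)) (hα : AnalyticOnNhd ℝ α (Set.Ioo (-ε) ε))
    {s : ℝ} (hs : s ∈ Set.Ioo (-(ε ^ k)) (ε ^ k)) :
    HasDerivAt (fun s => s • α (oddRoot k s))
      (α (oddRoot k s) + (oddRoot k s / k) • deriv α (oddRoot k s)) s := by
  have hk : k ≠ 0 := by rintro rfl; simp at hodd
  have hkR : (k : ℝ) ≠ 0 := by exact_mod_cast hk
  have hm := oddRoot_mem hodd hs
  by_cases h : s = 0
  · subst h
    rw [oddRoot_zero'] at hm ⊢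
    simp only [zero_div, zero_smul, add_zero]
    rw [hasDerivAt_iff_tendsto_slope]
    have hc : ContinuousAt (fun s => α (oddRoot k s)) 0 := by
      have h1 : ContinuousAt α (oddRoot k 0) := by
        rw [oddRoot_zero']; exact (hα 0 hm).continuousAt
      exact h1.comp (oddRoot_continuous hodd).continuousAt
    have h2 : Tendsto (fun s => α (oddRoot k s)) (𝓝[≠] 0) (𝓝 (α 0)) := by
      have := hc.tendsto.mono_left (nhdsWithin_le_nhds (s := {0}ᶜ))
      rwa [oddRoot_zero'] at this
    refine h2.congr' ?_
    filter_upwards [self_mem_nhdsWithin] with x hx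
    have hx' : x ≠ 0 := hx
    simp [slope, smul_smul, hx']
  · have hr : oddRoot k s ≠ 0 := by
      intro h'
      apply h
      rw [← oddRoot_pow hodd s, h', zero_pow hk]
    have hf : HasDerivAt (fun t : ℝ => t ^ k) (k * oddRoot k s ^ (k - 1)) (oddRoot k s) :=
      hasDerivAt_pow k _
    have hrd : HasDerivAt (oddRoot k) (k * oddRoot k s ^ (k - 1))⁻¹ s :=
      HasDerivAt.of_local_left_inverse (oddRoot_continuous hodd).continuousAt hf
        (mul_ne_zero hkR (pow_ne_zero _ hr)) (Eventually.of_forall (oddRoot_pow hodd))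
    have hαd : HasDerivAt α (deriv α (oddRoot k s)) (oddRoot k s) :=
      (hα _ hm).differentiableAt.hasDerivAt
    have h1 := (hasDerivAt_id s).smul (hαd.scomp s hrd)
    refine h1.congr_deriv ?_
    have hsr : s = oddRoot k s * oddRoot k s ^ (k - 1) := by
      rw [← pow_succ', Nat.sub_add_cancel (Nat.one_le_iff_ne_zero.2 hk), oddRoot_pow hodd]
    have h2 : s * (k * oddRoot k s ^ (k - 1))⁻¹ = oddRoot k s / k := by
      nth_rewrite 1 [hsr]
      field_simp
    simp only [id, Function.comp, one_smul, smul_smul, h2]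
    abel

/-- If `γ(t) = t^k • α(t)` is a real analytic curve germ, a homeomorphism
onto its image `Γ`, with `α(0) ≠ 0` and `k` odd, then `β(s) := γ(s^{1/k}) = s • α(s^{1/k})`
is `C¹` on `(−ε^k, ε^k)` with `β(0) = 0`, `β′(0) = α(0) ≠ 0`, and `β` is a homeomorphism
onto `Γ`; consequently `Γ` is `C¹` regular at `0`. -/
theorem stmt2 {n : ℕ} (ε : ℝ) (hε : 0 < ε)
    (γ α : ℝ → EuclideanSpace ℝ (Fin n)) (k : ℕ) (hk : 1 ≤ k) (hodd : Odd k)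
    (hγan : AnalyticOnNhd ℝ γ (Set.Ioo (-ε) ε))
    (hγ0 : γ 0 = 0)
    (hγne : ¬ ∀ t ∈ Set.Ioo (-ε) ε, γ t = 0)
    (hinj : Set.InjOn γ (Set.Ioo (-ε) ε))
    (hhomeo : ∃ δ : EuclideanSpace ℝ (Fin n) → ℝ,
      ContinuousOn δ (γ '' Set.Ioo (-ε) ε) ∧ ∀ t ∈ Set.Ioo (-ε) ε, δ (γ t) = t)
    (hαan : AnalyticOnNhd ℝ α (Set.Ioo (-ε) ε))
    (hα0 : α 0 ≠ 0)
    (hfac : ∀ t ∈ Set.Ioo (-ε) ε, γ t = t ^ k • α t) :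
    (∀ s ∈ Set.Ioo (-(ε ^ k)) (ε ^ k), γ (oddRoot k s) = s • α (oddRoot k s)) ∧
    ContDiffOn ℝ 1 (fun s => γ (oddRoot k s)) (Set.Ioo (-(ε ^ k)) (ε ^ k)) ∧
    γ (oddRoot k 0) = 0 ∧
    HasDerivAt (fun s => γ (oddRoot k s)) (α 0) 0 ∧ α 0 ≠ 0 ∧
    Set.BijOn (fun s => γ (oddRoot k s)) (Set.Ioo (-(ε ^ k)) (ε ^ k))
      (γ '' Set.Ioo (-ε) ε) ∧
    (∃ δ : EuclideanSpace ℝ (Fin n) → ℝ, ContinuousOn δ (γ '' Set.Ioo (-ε) ε) ∧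
      ∀ s ∈ Set.Ioo (-(ε ^ k)) (ε ^ k), δ (γ (oddRoot k s)) = s) ∧
    IsC1RegularAtZero (γ '' Set.Ioo (-ε) ε) := by
  have hfm : ∀ s ∈ Set.Ioo (-(ε ^ k)) (ε ^ k), γ (oddRoot k s) = s • α (oddRoot k s) := by
    intro s hs
    rw [hfac _ (oddRoot_mem hodd hs), oddRoot_pow hodd]
  have h0m : (0 : ℝ) ∈ Set.Ioo (-(ε ^ k)) (ε ^ k) := by
    have := pow_pos hε k
    constructor <;> linarith
  have hder : ∀ s ∈ Set.Ioo (-(ε ^ k)) (ε ^ k), HasDerivAt (fun s => γ (oddRoot k s))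
      (α (oddRoot k s) + (oddRoot k s / k) • deriv α (oddRoot k s)) s := by
    intro s hs
    refine (beta_deriv hodd α hαan hs).congr_of_eventuallyEq ?_
    filter_upwards [isOpen_Ioo.mem_nhds hs] with x hx using hfm x hx
  have hC1 : ContDiffOn ℝ 1 (fun s => γ (oddRoot k s)) (Set.Ioo (-(ε ^ k)) (ε ^ k)) := by
    rw [show (1 : WithTop ℕ∞) = 0 + 1 from rfl, contDiffOn_succ_iff_deriv_of_isOpen isOpen_Ioo]
    refine ⟨fun s hs => (hder s hs).differentiableAt.differentiableWithinAt, by simp, ?_⟩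
    rw [contDiffOn_zero]
    have hmaps : Set.MapsTo (oddRoot k) (Set.Ioo (-(ε ^ k)) (ε ^ k)) (Set.Ioo (-ε) ε) :=
      fun s hs => oddRoot_mem hodd hs
    have hrc := (oddRoot_continuous hodd).continuousOn (s := Set.Ioo (-(ε ^ k)) (ε ^ k))
    have hc : ContinuousOn (fun s => α (oddRoot k s) + (oddRoot k s / k) • deriv α (oddRoot k s))
        (Set.Ioo (-(ε ^ k)) (ε ^ k)) :=
      (hαan.continuousOn.comp hrc hmaps).add
        ((hrc.div_const _).smul (hαan.deriv.continuousOn.comp hrc hmaps))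
    exact hc.congr (fun s hs => (hder s hs).deriv)
  have hd0 : HasDerivAt (fun s => γ (oddRoot k s)) (α 0) 0 := by
    have := hder 0 h0m
    simpa [oddRoot_zero'] using this
  have hb0 : γ (oddRoot k 0) = 0 := by rw [oddRoot_zero', hγ0]
  have himg : (fun s => γ (oddRoot k s)) '' Set.Ioo (-(ε ^ k)) (ε ^ k) =
      γ '' Set.Ioo (-ε) ε := by
    ext x
    constructor
    · rintro ⟨s, hs, rfl⟩
      exact ⟨_, oddRoot_mem hodd hs, rfl⟩
    · rintro ⟨t, ht, rfl⟩
      refine ⟨t ^ k, pow_mem_aux hodd ht, ?_⟩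
      simp only [pow_oddRoot hodd]
  obtain ⟨δ, hδc, hδ⟩ := hhomeo
  have hδ' : ∀ s ∈ Set.Ioo (-(ε ^ k)) (ε ^ k), (fun x => δ x ^ k) (γ (oddRoot k s)) = s := by
    intro s hs
    simp only [hδ _ (oddRoot_mem hodd hs), oddRoot_pow hodd]
  refine ⟨hfm, hC1, hb0, hd0, hα0, ?_, ⟨fun x => δ x ^ k, hδc.pow k, hδ'⟩, ?_⟩
  · rw [← himg]
    refine Set.InjOn.bijOn_image ?_
    intro a ha b hb hab
    exact (oddRoot_strictMono hodd).injective
      (hinj (oddRoot_mem hodd ha) (oddRoot_mem hodd hb) hab)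
  · rw [← himg]
    refine regular_aux _ isOpen_Ioo h0m _ hC1 hb0 (α 0) hα0 hd0 (fun x => δ x ^ k) ?_ hδ'
    rw [himg]
    exact hδc.pow k
end

section
/- Let γ : (−ε, ε) → ℝⁿ be a real analytic map with γ(0) = 0 that is not identically zero and is a homeomorphism onto its image Γ := γ((−ε, ε)), and let k be the order of γ at 0. Then the following conditions are equivalent: (1) Γ is blow-spherical regular at 0; (2) the tangent cone C(Γ,0) is homeomorphic to ℝ; (3) C(Γ,0) is a real line through the origin, i.e., C(Γ,0) = {t·v : t ∈ ℝ} for some v ≠ 0; (4) k is odd; (5) Γ is C¹ regular at 0; (6) Γ is Lipschitz regular at 0, i.e., there is an open neighborhood U of 0 such that Γ ∩ U, with the Euclidean metric, is bi-Lipschitz homeomorphic to an open interval of ℝ. -/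
open Filter Set Topology

/-- The point of the spherical blow-up corresponding to `x ≠ 0`: `(x/‖x‖, ‖x‖)`. -/
noncomputable def sphBlowup {E : Type*} [NormedAddCommGroup E] [NormedSpace ℝ E]
    (x : E) : E × ℝ :=
  (‖x‖⁻¹ • x, ‖x‖)

/-- The strict transform `X′` of `X` under the spherical blow-up at the origin:
the closure of `β⁻¹(X \ {0})`. -/
def strictTransform {E : Type*} [NormedAddCommGroup E] [NormedSpace ℝ E]
    (X : Set E) : Set (E × ℝ) :=
  closure (sphBlowup '' (X \ {0}))

/-- The boundary `∂X′ = X′ ∩ (S^{n-1} × {0})` of the strict transform. -/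
def boundaryTransform {E : Type*} [NormedAddCommGroup E] [NormedSpace ℝ E]
    (X : Set E) : Set (E × ℝ) :=
  strictTransform X ∩ {p | p.2 = 0}

/-- `φ : (X,0) → (Y,0)` is a blow-spherical homeomorphism: a homeomorphism of `X`
onto `Y` fixing `0` such that `(x,r) ↦ (φ(rx)/‖φ(rx)‖, ‖φ(rx)‖)` extends to a
homeomorphism of the strict transforms. -/
def IsBlowSphericalHomeo {E F : Type*} [NormedAddCommGroup E] [NormedSpace ℝ E]
    [NormedAddCommGroup F] [NormedSpace ℝ F] (X : Set E) (Y : Set F) (φ : E → F) : Prop :=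
  φ 0 = 0 ∧ Set.BijOn φ X Y ∧ ContinuousOn φ X ∧
    (∃ ψ : F → E, Set.InvOn ψ φ X Y ∧ ContinuousOn ψ Y) ∧
    ∃ Φ : E × ℝ → F × ℝ,
      Set.BijOn Φ (strictTransform X) (strictTransform Y) ∧
      ContinuousOn Φ (strictTransform X) ∧
      (∃ Ψ : F × ℝ → E × ℝ, Set.InvOn Ψ Φ (strictTransform X) (strictTransform Y) ∧
        ContinuousOn Ψ (strictTransform Y)) ∧
      ∀ x ∈ X \ {0}, Φ (sphBlowup x) = sphBlowup (φ x)

/-- `X` is blow-spherical regular at `0`: for some open neighborhood `U` of `0`,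
`(X ∩ U, 0)` is blow-spherical homeomorphic to a Euclidean ball centered at the
origin of some `ℝ^d`. -/
def BlowSphericalRegularAtZero {E : Type*} [NormedAddCommGroup E] [NormedSpace ℝ E]
    (X : Set E) : Prop :=
  ∃ U : Set E, IsOpen U ∧ (0 : E) ∈ U ∧
    ∃ (d : ℕ) (r : ℝ), 0 < r ∧ ∃ φ : E → EuclideanSpace ℝ (Fin d),
      IsBlowSphericalHomeo (X ∩ U) (Metric.ball (0 : EuclideanSpace ℝ (Fin d)) r) φ

/-- `X ⊆ ℝⁿ` is Lipschitz regular at `0`, with model an open interval: for some open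
neighborhood `U` of `0`, `X ∩ U` with the Euclidean metric is bi-Lipschitz
homeomorphic to an open interval of `ℝ`. -/
def LipschitzRegularToIntervalAtZero {n : ℕ} (X : Set (EuclideanSpace ℝ (Fin n))) : Prop :=
  ∃ U : Set (EuclideanSpace ℝ (Fin n)), IsOpen U ∧ 0 ∈ U ∧
    ∃ (a b : ℝ), a < b ∧ ∃ f : EuclideanSpace ℝ (Fin n) → ℝ,
      Set.BijOn f (X ∩ U) (Set.Ioo a b) ∧
      ∃ K : ℝ, 1 ≤ K ∧ ∀ x ∈ X ∩ U, ∀ y ∈ X ∩ U,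
        K⁻¹ * dist x y ≤ dist (f x) (f y) ∧ dist (f x) (f y) ≤ K * dist x y


structure CurveHyp {n : ℕ} (ε : ℝ) (γ α : ℝ → EuclideanSpace ℝ (Fin n))
    (δ : EuclideanSpace ℝ (Fin n) → ℝ) (k : ℕ) : Prop where
  hε : 0 < ε
  hk : 1 ≤ k
  hγ0 : γ 0 = 0
  hinj : Set.InjOn γ (Set.Ioo (-ε) ε)
  hδ : ContinuousOn δ (γ '' Set.Ioo (-ε) ε)
  hδγ : ∀ t ∈ Set.Ioo (-ε) ε, δ (γ t) = t
  hαan : AnalyticOnNhd ℝ α (Set.Ioo (-ε) ε)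
  hα0 : α 0 ≠ 0
  hfac : ∀ t ∈ Set.Ioo (-ε) ε, γ t = t ^ k • α t

namespace CurveHyp

variable {n : ℕ} {ε : ℝ} {γ α : ℝ → EuclideanSpace ℝ (Fin n)}
    {δ : EuclideanSpace ℝ (Fin n) → ℝ} {k : ℕ}

lemma zero_mem (H : CurveHyp ε γ α δ k) : (0:ℝ) ∈ Ioo (-ε) ε := ⟨by linarith [H.hε], H.hε⟩

lemma I_nhds (H : CurveHyp ε γ α δ k) : Ioo (-ε) ε ∈ 𝓝 (0:ℝ) :=
  isOpen_Ioo.mem_nhds H.zero_mem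

lemma αcont (H : CurveHyp ε γ α δ k) : ContinuousOn α (Ioo (-ε) ε) := H.hαan.continuousOn

lemma αcont0 (H : CurveHyp ε γ α δ k) : Tendsto α (𝓝 0) (𝓝 (α 0)) :=
  H.αcont.continuousAt H.I_nhds

lemma γcont (H : CurveHyp ε γ α δ k) : ContinuousOn γ (Ioo (-ε) ε) :=
  ((continuous_pow k).continuousOn.smul H.αcont).congr H.hfac

lemma γcont0 (H : CurveHyp ε γ α δ k) : Tendsto γ (𝓝 0) (𝓝 0) := by
  have := H.γcont.continuousAt H.I_nhds
  rwa [ContinuousAt, H.hγ0] at this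

lemma γne (H : CurveHyp ε γ α δ k) {t : ℝ} (ht : t ∈ Ioo (-ε) ε) (h : t ≠ 0) : γ t ≠ 0 := by
  intro h'
  exact h (H.hinj ht H.zero_mem (h'.trans H.hγ0.symm))

lemma αne (H : CurveHyp ε γ α δ k) {t : ℝ} (ht : t ∈ Ioo (-ε) ε) : α t ≠ 0 := by
  by_cases h : t = 0
  · rw [h]; exact H.hα0
  · intro h'
    apply H.γne ht h
    rw [H.hfac t ht, h', smul_zero]

lemma δ0 (H : CurveHyp ε γ α δ k) : δ 0 = 0 := by
  have := H.hδγ 0 H.zero_mem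
  rwa [H.hγ0] at this

lemma zero_memΓ (H : CurveHyp ε γ α δ k) : (0 : EuclideanSpace ℝ (Fin n)) ∈ γ '' Ioo (-ε) ε :=
  ⟨0, H.zero_mem, H.hγ0⟩

lemma δtend (H : CurveHyp ε γ α δ k) : Tendsto δ (𝓝[γ '' Ioo (-ε) ε] 0) (𝓝 0) := by
  have := H.hδ 0 H.zero_memΓ
  rwa [ContinuousWithinAt, H.δ0] at this

lemma δspec (H : CurveHyp ε γ α δ k) {x} (hx : x ∈ γ '' Ioo (-ε) ε) :
    δ x ∈ Ioo (-ε) ε ∧ γ (δ x) = x := by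
  obtain ⟨t, ht, rfl⟩ := hx
  rw [H.hδγ t ht]; exact ⟨ht, rfl⟩

lemma δne (H : CurveHyp ε γ α δ k) {x} (hx : x ∈ γ '' Ioo (-ε) ε) (h : x ≠ 0) : δ x ≠ 0 := by
  intro h'
  apply h
  rw [← (H.δspec hx).2, h', H.hγ0]

lemma exists_U (H : CurveHyp ε γ α δ k) {η : ℝ} (h0 : 0 < η) (h1 : η ≤ ε) :
    ∃ U : Set (EuclideanSpace ℝ (Fin n)), IsOpen U ∧ 0 ∈ U ∧
      γ '' Ioo (-ε) ε ∩ U = γ '' Ioo (-η) η := by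
  obtain ⟨U, hU, hU'⟩ := continuousOn_iff'.1 H.hδ (Ioo (-η) η) isOpen_Ioo
  have hmem : ∀ t ∈ Ioo (-ε) ε, (γ t ∈ U ↔ t ∈ Ioo (-η) η) := by
    intro t ht
    have := Set.ext_iff.1 hU' (γ t)
    simp only [mem_inter_iff, mem_preimage, mem_image_of_mem γ ht, and_true, H.hδγ t ht] at this
    exact this.symm
  refine ⟨U, hU, ?_, ?_⟩
  · have := (hmem 0 H.zero_mem).2 ⟨by linarith, h0⟩
    rwa [H.hγ0] at this
  · ext x
    constructor
    · rintro ⟨⟨t, ht, rfl⟩, hx⟩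
      exact ⟨t, (hmem t ht).1 hx, rfl⟩
    · rintro ⟨t, ht, rfl⟩
      have ht' : t ∈ Ioo (-ε) ε := ⟨by linarith [ht.1], by linarith [ht.2]⟩
      exact ⟨⟨t, ht', rfl⟩, (hmem t ht').2 ht⟩

/-- convenient criterion for membership in the cone -/
lemma cone_mem {X : Set (EuclideanSpace ℝ (Fin n))} {v : EuclideanSpace ℝ (Fin n)}
    (f : ℝ → EuclideanSpace ℝ (Fin n)) (τ : ℝ → ℝ)
    (h1 : ∀ᶠ s in 𝓝[>] (0:ℝ), f s ∈ X \ {0}) (h2 : Tendsto f (𝓝[>] 0) (𝓝 0))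
    (h3 : ∀ᶠ s in 𝓝[>] (0:ℝ), 0 < τ s)
    (h4 : Tendsto (fun s => (τ s)⁻¹ • f s) (𝓝[>] 0) (𝓝 v)) :
    v ∈ tangentConeAtZero X := by
  obtain ⟨u, hu⟩ := exists_seq_tendsto (𝓝[>] (0:ℝ))
  obtain ⟨N, hN⟩ := eventually_atTop.1 (hu.eventually (h1.and h3))
  have hu' : Tendsto (fun i => u (i + N)) atTop (𝓝[>] 0) := hu.comp (tendsto_add_atTop_nat N)
  exact ⟨fun i => f (u (i + N)), fun i => τ (u (i + N)), fun i => (hN _ (by omega)).1,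
    h2.comp hu', fun i => (hN _ (by omega)).2, h4.comp hu'⟩

lemma cone_sub (H : CurveHyp ε γ α δ k) {v} (hv : v ∈ tangentConeAtZero (γ '' Ioo (-ε) ε)) :
    ∃ c : ℝ, v = c • α 0 ∧ (Even k → 0 ≤ c) := by
  obtain ⟨x, τ, hx, hx0, hτ, hlim⟩ := hv
  set a := α 0 with ha
  have haa : (inner ℝ a a : ℝ) ≠ 0 := by
    simpa using H.hα0
  have ht : Tendsto (fun i => δ (x i)) atTop (𝓝 0) :=
    H.δtend.comp (tendsto_nhdsWithin_iff.2 ⟨hx0, Eventually.of_forall fun i => (hx i).1⟩)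
  have hα : Tendsto (fun i => α (δ (x i))) atTop (𝓝 a) := H.αcont0.comp ht
  have hin : Tendsto (fun i => (inner ℝ (α (δ (x i))) a : ℝ)) atTop (𝓝 (inner ℝ a a)) :=
    hα.inner tendsto_const_nhds
  have hy : ∀ i, (τ i)⁻¹ • x i = ((τ i)⁻¹ * (δ (x i)) ^ k) • α (δ (x i)) := by
    intro i
    obtain ⟨h1, h2⟩ := H.δspec (hx i).1
    rw [mul_smul, ← H.hfac _ h1, h2]
  have hc : Tendsto (fun i => (τ i)⁻¹ * (δ (x i)) ^ k) atTop (𝓝 ((inner ℝ v a : ℝ) / inner ℝ a a)) := by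
    have h1 : Tendsto (fun i => (inner ℝ ((τ i)⁻¹ • x i) a : ℝ) / inner ℝ (α (δ (x i))) a) atTop
        (𝓝 ((inner ℝ v a : ℝ) / inner ℝ a a)) :=
      (hlim.inner tendsto_const_nhds).div hin haa
    refine h1.congr' ?_
    filter_upwards [hin.eventually_ne haa] with i hi
    rw [hy, real_inner_smul_left, mul_div_assoc, div_self hi, mul_one]
  refine ⟨_, tendsto_nhds_unique hlim ?_, fun hk => ge_of_tendsto' hc ?_⟩
  · simp_rw [hy]
    exact hc.smul hα
  · intro i
    have := hτ i
    have := hk.pow_nonneg (δ (x i))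
    positivity

lemma mem_cone (H : CurveHyp ε γ α δ k) {c : ℝ} (h : Odd k ∨ 0 ≤ c) :
    c • α 0 ∈ tangentConeAtZero (γ '' Ioo (-ε) ε) := by
  have hs : ∀ᶠ s in 𝓝[>] (0:ℝ), s ∈ Ioo (-ε) ε ∧ 0 < s :=
    (eventually_nhdsWithin_of_eventually_nhds H.I_nhds).and self_mem_nhdsWithin
  have hid : Tendsto (fun s : ℝ => s) (𝓝[>] 0) (𝓝 0) := tendsto_id.mono_left nhdsWithin_le_nhds
  have hneg : Tendsto (fun s : ℝ => -s) (𝓝[>] 0) (𝓝 0) := by simpa using hid.neg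
  by_cases hc : 0 ≤ c
  · refine cone_mem γ (fun s => s ^ k / (c + s)) ?_ (H.γcont0.comp hid) ?_ ?_
    · filter_upwards [hs] with s hs
      exact ⟨⟨s, hs.1, rfl⟩, H.γne hs.1 hs.2.ne'⟩
    · filter_upwards [hs] with s ⟨_, hs⟩
      positivity
    · have : Tendsto (fun s => (c + s) • α s) (𝓝[>] 0) (𝓝 ((c + 0) • α 0)) :=
        (hid.const_add c).smul (H.αcont0.comp hid)
      rw [add_zero] at this
      refine this.congr' ?_
      filter_upwards [hs] with s hs
      rw [H.hfac s hs.1, smul_smul]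
      have := hs.2
      congr 1
      have : c + s ≠ 0 := by positivity
      field_simp
  · have hk := h.resolve_right hc
    push Not at hc
    refine cone_mem (fun s => γ (-s)) (fun s => (-s) ^ k / (c - s)) ?_ (H.γcont0.comp hneg) ?_ ?_
    · filter_upwards [hs] with s hs
      have : -s ∈ Ioo (-ε) ε := ⟨by linarith [hs.1.2], by linarith [hs.1.1]⟩
      exact ⟨⟨-s, this, rfl⟩, H.γne this (by linarith [hs.2])⟩
    · filter_upwards [hs] with s ⟨_, hs⟩
      exact div_pos_of_neg_of_neg (hk.pow_neg (by linarith)) (by linarith)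
    · have : Tendsto (fun s => (c - s) • α (-s)) (𝓝[>] 0) (𝓝 ((c - 0) • α 0)) :=
        (hid.const_sub c).smul (H.αcont0.comp hneg)
      rw [sub_zero] at this
      refine this.congr' ?_
      filter_upwards [hs] with s hs
      have h' : -s ∈ Ioo (-ε) ε := ⟨by linarith [hs.1.2], by linarith [hs.1.1]⟩
      rw [H.hfac _ h', smul_smul]
      congr 1
      have h1 : c - s ≠ 0 := by linarith [hs.2]
      have h2 : (-s) ^ k ≠ 0 := pow_ne_zero _ (by linarith [hs.2])
      field_simp

lemma four_three (H : CurveHyp ε γ α δ k) (hk : Odd k) :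
    ∃ v : EuclideanSpace ℝ (Fin n), v ≠ 0 ∧
        tangentConeAtZero (γ '' Set.Ioo (-ε) ε) = Set.range (fun t : ℝ => t • v) := by
  refine ⟨α 0, H.hα0, ?_⟩
  ext v
  constructor
  · intro hv
    obtain ⟨c, hc, _⟩ := H.cone_sub hv
    exact ⟨c, hc.symm⟩
  · rintro ⟨c, rfl⟩
    exact H.mem_cone (Or.inl hk)

lemma three_two {S : Set (EuclideanSpace ℝ (Fin n))} (h : ∃ v : EuclideanSpace ℝ (Fin n), v ≠ 0 ∧
        S = Set.range (fun t : ℝ => t • v)) : Nonempty (↥S ≃ₜ ℝ) := by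
  obtain ⟨v, hv, rfl⟩ := h
  have hvv : (inner ℝ v v : ℝ) ≠ 0 := by simpa using hv
  have hv2 : ∀ t : ℝ, (inner ℝ (t • v) v : ℝ) / inner ℝ v v = t := by
    intro t
    rw [real_inner_smul_left, mul_div_assoc, div_self hvv, mul_one]
  exact ⟨{
    toFun := fun x => (inner ℝ (x : EuclideanSpace ℝ (Fin n)) v : ℝ) / inner ℝ v v
    invFun := fun t => ⟨t • v, t, rfl⟩
    left_inv := by
      rintro ⟨_, t, rfl⟩
      apply Subtype.ext
      simp only [hv2]
    right_inv := fun t => hv2 t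
    continuous_toFun := (continuous_subtype_val.inner continuous_const).div_const _
    continuous_invFun := (continuous_id.smul continuous_const).subtype_mk _ }⟩

lemma two_four (H : CurveHyp ε γ α δ k)
    (h : Nonempty (↥(tangentConeAtZero (γ '' Set.Ioo (-ε) ε)) ≃ₜ ℝ)) : Odd k := by
  by_contra hk
  rw [Nat.not_odd_iff_even] at hk
  obtain ⟨h⟩ := h
  let F : ℝ → ℝ := fun c => h ⟨max c 0 • α 0, H.mem_cone (Or.inr (le_max_right _ _))⟩
  have hF : Continuous F := by
    apply h.continuous.comp
    apply Continuous.subtype_mk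
    exact (continuous_id.max continuous_const).smul continuous_const
  have hsurj : ∀ y, ∃ c, 0 ≤ c ∧ F c = y := by
    intro y
    obtain ⟨c, hc, hc0⟩ := H.cone_sub (h.symm y).2
    refine ⟨c, hc0 hk, ?_⟩
    have : (⟨max c 0 • α 0, H.mem_cone (Or.inr (le_max_right _ _))⟩ :
      ↥(tangentConeAtZero (γ '' Set.Ioo (-ε) ε))) = h.symm y := by
      apply Subtype.ext
      rw [hc]; simp only [max_eq_left (hc0 hk)]
    simp only [F, this, h.apply_symm_apply]
  have hpre : (F '' Ioi 0).OrdConnected :=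
    (isPreconnected_Ioi.image F hF.continuousOn).ordConnected
  have hm : ∀ y, y ≠ F 0 → y ∈ F '' Ioi 0 := by
    intro y hy
    obtain ⟨c, hc, rfl⟩ := hsurj y
    rcases hc.lt_or_eq with hc | hc
    · exact ⟨c, hc, rfl⟩
    · rw [← hc] at hy; exact absurd rfl hy
  obtain ⟨c, hc, hc'⟩ := hpre.out (hm (F 0 - 1) (by linarith)) (hm (F 0 + 1) (by linarith))
    (show F 0 ∈ Icc _ _ from ⟨by linarith, by linarith⟩)
  have := congrArg Subtype.val (h.injective hc')
  simp only [max_self, zero_smul, smul_eq_zero, H.hα0, or_false] at this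
  rw [max_eq_left (le_of_lt hc)] at this
  exact (ne_of_gt hc) this

lemma one_four (H : CurveHyp ε γ α δ k)
    (h : BlowSphericalRegularAtZero (γ '' Set.Ioo (-ε) ε)) : Odd k := by
  by_contra hk
  rw [Nat.not_odd_iff_even] at hk
  obtain ⟨U, hU, h0U, d, r, hr, φ, hφ0, hφ, hφc, ⟨ψ, hψ, hψc⟩, Φ, hΦ, hΦc, -, hext⟩ := h
  set X := γ '' Ioo (-ε) ε ∩ U with hX
  have h0X : (0 : EuclideanSpace ℝ (Fin n)) ∈ X := ⟨H.zero_memΓ, h0U⟩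
  have hψ0 : ψ 0 = 0 := by
    have := hψ.1 h0X
    rwa [hφ0] at this
  have hψm : MapsTo ψ (Metric.ball 0 r) X := by
    intro y hy
    obtain ⟨x, hx, rfl⟩ := hφ.surjOn hy
    rw [hψ.1 hx]; exact hx
  -- limit of the blow-up
  have hlim : Tendsto sphBlowup (𝓝[X \ {0}] 0) (𝓝 (‖α 0‖⁻¹ • α 0, (0:ℝ))) := by
    have ht : Tendsto δ (𝓝[X \ {0}] 0) (𝓝 0) :=
      H.δtend.mono_left (nhdsWithin_mono _ fun x hx => hx.1.1)
    have hα : Tendsto (fun x => α (δ x)) (𝓝[X \ {0}] 0) (𝓝 (α 0)) := H.αcont0.comp ht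
    have h1 : Tendsto (fun x => ‖α (δ x)‖⁻¹ • α (δ x)) (𝓝[X \ {0}] 0) (𝓝 (‖α 0‖⁻¹ • α 0)) :=
      (hα.norm.inv₀ (norm_ne_zero_iff.2 H.hα0)).smul hα
    have h2 : Tendsto (fun x : EuclideanSpace ℝ (Fin n) => ‖x‖) (𝓝[X \ {0}] 0) (𝓝 0) :=
      (tendsto_norm_zero).mono_left nhdsWithin_le_nhds
    refine (h1.prodMk_nhds h2).congr' ?_
    filter_upwards [self_mem_nhdsWithin] with x hx
    have hne := H.δne hx.1.1 hx.2
    obtain ⟨hI, hx'⟩ := H.δspec hx.1.1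
    have hpos : 0 < (δ x) ^ k := hk.pow_pos hne
    have hx2 : x = (δ x) ^ k • α (δ x) := by rw [← H.hfac _ hI, hx']
    have hn : ‖α (δ x)‖ ≠ 0 := norm_ne_zero_iff.2 (H.αne hI)
    have : ‖α (δ x)‖⁻¹ • α (δ x) = ‖x‖⁻¹ • x := by
      conv_rhs => rw [hx2]
      rw [norm_smul, Real.norm_of_nonneg hpos.le, smul_smul]
      congr 1
      field_simp
    simp only [sphBlowup, this]
  have hX'mem : ∀ x ∈ X \ {0}, sphBlowup x ∈ strictTransform X := fun x hx =>
    subset_closure ⟨x, hx, rfl⟩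
  -- key
  have key : ∀ w : EuclideanSpace ℝ (Fin d), ‖w‖ = 1 →
      Tendsto sphBlowup (𝓝[X \ {0}] 0) (𝓝 (‖α 0‖⁻¹ • α 0, (0:ℝ))) →
      (w, (0:ℝ)) = Φ (‖α 0‖⁻¹ • α 0, (0:ℝ)) := by
    intro w hw hlim
    have hid : Tendsto (fun s : ℝ => s) (𝓝[>] 0) (𝓝 0) := tendsto_id.mono_left nhdsWithin_le_nhds
    have hsw : Tendsto (fun s : ℝ => s • w) (𝓝[>] 0) (𝓝 0) := by
      simpa using hid.smul (tendsto_const_nhds (x := w))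
    have hball : ∀ᶠ s in 𝓝[>] (0:ℝ), s • w ∈ Metric.ball (0 : EuclideanSpace ℝ (Fin d)) r :=
      hsw (Metric.ball_mem_nhds _ hr)
    have hwne : w ≠ 0 := by intro h; simp [h] at hw
    have hψt : Tendsto (fun s : ℝ => ψ (s • w)) (𝓝[>] 0) (𝓝[X \ {0}] 0) := by
      refine tendsto_nhdsWithin_iff.2 ⟨?_, ?_⟩
      · have := (hψc 0 (Metric.mem_ball_self hr)).tendsto
        rw [hψ0] at this
        exact this.comp (tendsto_nhdsWithin_iff.2 ⟨hsw, hball⟩)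
      · filter_upwards [hball, self_mem_nhdsWithin] with s hs hs0
        refine ⟨hψm hs, ?_⟩
        intro h
        have h2 := hψ.2 hs
        rw [mem_singleton_iff.1 h, hφ0] at h2
        exact smul_ne_zero (ne_of_gt hs0) hwne h2.symm
    have hmem : ∀ᶠ s in 𝓝[>] (0:ℝ), sphBlowup (ψ (s • w)) ∈ strictTransform X :=
      (hψt.eventually self_mem_nhdsWithin).mono fun s hs => hX'mem _ hs
    have hcl : (‖α 0‖⁻¹ • α 0, (0:ℝ)) ∈ strictTransform X :=
      isClosed_closure.mem_of_tendsto (hlim.comp hψt) hmem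
    have h3 : Tendsto (fun s : ℝ => Φ (sphBlowup (ψ (s • w)))) (𝓝[>] 0)
        (𝓝 (Φ (‖α 0‖⁻¹ • α 0, (0:ℝ)))) :=
      (hΦc _ hcl).tendsto.comp (tendsto_nhdsWithin_iff.2 ⟨hlim.comp hψt, hmem⟩)
    have h4 : Tendsto (fun s : ℝ => (w, s)) (𝓝[>] 0) (𝓝 (w, (0:ℝ))) :=
      tendsto_const_nhds.prodMk_nhds hid
    refine tendsto_nhds_unique (h4.congr' ?_) h3
    filter_upwards [hball, self_mem_nhdsWithin, hψt.eventually self_mem_nhdsWithin] with s hs hs0 hs1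
    have hs0 : 0 < s := hs0
    rw [hext _ hs1, hψ.2 hs, sphBlowup, norm_smul, hw, Real.norm_of_nonneg hs0.le, mul_one,
      smul_smul, inv_mul_cancel₀ hs0.ne', one_smul]
  -- a unit vector
  have hd : ∃ w : EuclideanSpace ℝ (Fin d), ‖w‖ = 1 := by
    have h1 : ∀ᶠ t in 𝓝[≠] (0:ℝ), t ∈ Ioo (-ε) ε ∧ γ t ∈ U ∧ t ≠ 0 := by
      filter_upwards [eventually_nhdsWithin_of_eventually_nhds H.I_nhds,
        eventually_nhdsWithin_of_eventually_nhds (H.γcont0 (hU.mem_nhds h0U)),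
        self_mem_nhdsWithin] with t h1 h2 h3
      exact ⟨h1, h2, h3⟩
    obtain ⟨t, ht, htU, ht0⟩ := h1.exists
    have hne : φ (γ t) ≠ 0 := by
      intro h
      rw [← hφ0] at h
      exact H.γne ht ht0 (hφ.injOn ⟨⟨t, ht, rfl⟩, htU⟩ h0X h)
    exact ⟨‖φ (γ t)‖⁻¹ • φ (γ t), norm_smul_inv_norm hne⟩
  obtain ⟨w, hw⟩ := hd
  have e1 := key w hw hlim
  have e2 := key (-w) (by rwa [norm_neg]) hlim
  have e3 : w = -w := congrArg Prod.fst (e1.trans e2.symm)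
  have e4 : (2:ℝ) • w = 0 := by
    rw [two_smul]; nth_rewrite 1 [e3]; simp
  have e5 : w = 0 := (smul_eq_zero.1 e4).resolve_left (by norm_num)
  simp [e5] at hw

lemma four_one (H : CurveHyp ε γ α δ k) (hk : Odd k) :
    BlowSphericalRegularAtZero (γ '' Set.Ioo (-ε) ε) := by
  have hε := H.hε
  obtain ⟨η, hη0, hηε⟩ : ∃ η, 0 < η ∧ η < ε := exists_between hε
  obtain ⟨U, hU, h0U, hXU⟩ := H.exists_U hη0 hηε.le
  have hsub : Ioo (-η) η ⊆ Ioo (-ε) ε := Ioo_subset_Ioo (by linarith) hηε.le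
  refine ⟨U, hU, h0U, 1, η, hη0, fun x => WithLp.toLp 2 (fun _ => δ x), ?_⟩
  rw [hXU]
  set X := γ '' Ioo (-η) η with hX
  have hnorm : ∀ v : EuclideanSpace ℝ (Fin 1), ‖v‖ = |v 0| := by
    intro v
    rw [EuclideanSpace.norm_eq]
    simp [Real.sqrt_sq_eq_abs]
  have hball : ∀ v : EuclideanSpace ℝ (Fin 1), v ∈ Metric.ball 0 η ↔ v 0 ∈ Ioo (-η) η := by
    intro v
    rw [mem_ball_zero_iff, hnorm, abs_lt]; rfl
  have hext1 : ∀ v w : EuclideanSpace ℝ (Fin 1), v 0 = w 0 → v = w := by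
    intro v w h
    ext i
    rw [Subsingleton.elim i 0, h]
  have hXδ : ∀ x ∈ X, δ x ∈ Ioo (-η) η ∧ γ (δ x) = x := by
    rintro _ ⟨t, ht, rfl⟩
    rw [H.hδγ t (hsub ht)]; exact ⟨ht, rfl⟩
  let φ : EuclideanSpace ℝ (Fin n) → EuclideanSpace ℝ (Fin 1) := fun x => WithLp.toLp 2 (fun _ => δ x)
  let ψ : EuclideanSpace ℝ (Fin 1) → EuclideanSpace ℝ (Fin n) := fun v => γ (v 0)
  have hφ0 : φ 0 = 0 := by
    apply hext1; simp [φ, H.δ0]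
  have hinv : InvOn ψ φ X (Metric.ball 0 η) := by
    constructor
    · intro x hx
      exact (hXδ x hx).2
    · intro v hv
      apply hext1
      exact H.hδγ _ (hsub ((hball v).1 hv))
  have hmφ : MapsTo φ X (Metric.ball 0 η) := fun x hx => (hball _).2 (hXδ x hx).1
  have hmψ : MapsTo ψ (Metric.ball 0 η) X := fun v hv => ⟨v 0, (hball v).1 hv, rfl⟩
  have hbij : BijOn φ X (Metric.ball 0 η) := hinv.bijOn hmφ hmψ
  have hc0 : Continuous (fun v : EuclideanSpace ℝ (Fin 1) => v 0) := by fun_prop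
  have hφc : ContinuousOn φ X := by
    have : ContinuousOn δ X := H.hδ.mono (image_mono hsub)
    have h2 : Continuous (fun t : ℝ => (WithLp.toLp 2 (fun _ => t) : EuclideanSpace ℝ (Fin 1))) := by
      fun_prop
    exact h2.comp_continuousOn this
  have hψc : ContinuousOn ψ (Metric.ball 0 η) :=
    H.γcont.comp hc0.continuousOn fun v hv => hsub ((hball v).1 hv)
  -- the compact model
  let K : Set (EuclideanSpace ℝ (Fin 1) × ℝ) := Metric.sphere 0 1 ×ˢ Icc 0 η
  have hK : IsCompact K := (isCompact_sphere _ _).prod isCompact_Icc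
  have hKs : ∀ p ∈ K, (p.1 0 = 1 ∨ p.1 0 = -1) ∧ 0 ≤ p.2 ∧ p.2 ≤ η := by
    rintro ⟨v, τ⟩ ⟨h1, h2⟩
    have : |v 0| = 1 := by rw [← hnorm]; simpa using h1
    exact ⟨eq_or_eq_neg_of_abs_eq this, h2.1, h2.2⟩
  have hKI : ∀ p ∈ K, p.1 0 * p.2 ∈ Ioo (-ε) ε := by
    intro p hp
    obtain ⟨h1, h2, h3⟩ := hKs p hp
    rcases h1 with h1 | h1 <;> rw [h1] <;> constructor <;> linarith
  have hYK : strictTransform (Metric.ball (0 : EuclideanSpace ℝ (Fin 1)) η) ⊆ K := by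
    apply closure_minimal _ hK.isClosed
    rintro _ ⟨v, ⟨hv, hv0⟩, rfl⟩
    refine ⟨?_, norm_nonneg _, ?_⟩
    · rw [mem_sphere_zero_iff_norm]; exact norm_smul_inv_norm hv0
    · exact (mem_ball_zero_iff.1 hv).le
  let Q : EuclideanSpace ℝ (Fin 1) × ℝ → EuclideanSpace ℝ (Fin n) × ℝ := fun p =>
    (p.1 0 • (‖α (p.1 0 * p.2)‖⁻¹ • α (p.1 0 * p.2)), p.2 ^ k * ‖α (p.1 0 * p.2)‖)
  have hQc : ContinuousOn Q K := by
    have h1 : ContinuousOn (fun p : EuclideanSpace ℝ (Fin 1) × ℝ => p.1 0) K :=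
      (hc0.comp continuous_fst).continuousOn
    have h2 : ContinuousOn (fun p : EuclideanSpace ℝ (Fin 1) × ℝ => α (p.1 0 * p.2)) K :=
      H.αcont.comp (h1.mul continuous_snd.continuousOn) hKI
    refine ContinuousOn.prodMk (h1.smul ((h2.norm.inv₀ ?_).smul h2))
      ((continuous_snd.pow k).continuousOn.mul h2.norm)
    intro p hp
    exact norm_ne_zero_iff.2 (H.αne (hKI p hp))
  have hQγ : ∀ p ∈ K, (Q p).2 • (Q p).1 = γ (p.1 0 * p.2) := by
    intro p hp
    have hn : ‖α (p.1 0 * p.2)‖ ≠ 0 := norm_ne_zero_iff.2 (H.αne (hKI p hp))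
    rw [H.hfac _ (hKI p hp)]
    simp only [Q, smul_smul]
    congr 1
    have : (p.1 0) ^ k = p.1 0 := by
      rcases (hKs p hp).1 with h | h <;> rw [h]
      · simp
      · exact hk.neg_one_pow
    rw [mul_pow, this]
    field_simp
  have hQi : InjOn Q K := by
    intro p hp q hq hpq
    have h1 : p.1 0 * p.2 = q.1 0 * q.2 := by
      apply H.hinj (hKI p hp) (hKI q hq)
      rw [← hQγ p hp, ← hQγ q hq, hpq]
    obtain ⟨a1, a2, a3⟩ := hKs p hp
    obtain ⟨b1, b2, b3⟩ := hKs q hq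
    have h2 : p.2 = q.2 := by
      have := congrArg abs h1
      rw [abs_mul, abs_mul, abs_of_nonneg a2, abs_of_nonneg b2] at this
      rcases a1 with h | h <;> rcases b1 with h' | h' <;> rw [h, h'] at this <;> simpa using this
    have h3 : p.1 0 = q.1 0 := by
      have := congrArg Prod.fst hpq
      simp only [Q, h1] at this
      have hne : ‖α (q.1 0 * q.2)‖⁻¹ • α (q.1 0 * q.2) ≠ 0 :=
        smul_ne_zero (inv_ne_zero (norm_ne_zero_iff.2 (H.αne (hKI q hq)))) (H.αne (hKI q hq))
      exact smul_left_injective ℝ hne this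
    exact Prod.ext (hext1 _ _ h3) h2
  have hQs : ∀ v ∈ Metric.ball (0 : EuclideanSpace ℝ (Fin 1)) η \ {0},
      Q (sphBlowup v) = sphBlowup (ψ v) := by
    rintro v ⟨hv, hv0⟩
    have hvI := hsub ((hball v).1 hv)
    have hn0 : ‖v‖ ≠ 0 := norm_ne_zero_iff.2 hv0
    have hmem : sphBlowup v ∈ K := hYK (subset_closure ⟨v, ⟨hv, hv0⟩, rfl⟩)
    have e : (sphBlowup v).1 0 * (sphBlowup v).2 = v 0 := by
      simp only [sphBlowup, PiLp.smul_apply, smul_eq_mul]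
      field_simp
    have hγ := hQγ _ hmem
    rw [e] at hγ
    have hn : ‖α (v 0)‖ ≠ 0 := norm_ne_zero_iff.2 (H.αne hvI)
    have e2 : (Q (sphBlowup v)).2 = ‖γ (v 0)‖ := by
      simp only [Q, e]
      rw [H.hfac _ hvI, norm_smul, norm_pow, Real.norm_eq_abs, ← hnorm]; rfl
    have hγn : ‖γ (v 0)‖ ≠ 0 := by
      rw [norm_ne_zero_iff]
      apply H.γne hvI
      intro h; exact hn0 (by rw [hnorm, h, abs_zero])
    apply Prod.ext
    · rw [e2] at hγ
      change (Q (sphBlowup v)).1 = ‖γ (v 0)‖⁻¹ • γ (v 0)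
      rw [eq_inv_smul_iff₀ hγn, hγ]
    · exact e2
  set Y := Metric.ball (0 : EuclideanSpace ℝ (Fin 1)) η with hY
  have hYc : IsCompact (strictTransform Y) := hK.of_isClosed_subset isClosed_closure hYK
  have hψbij : BijOn ψ Y X := hinv.symm.bijOn hmψ hmφ
  have hψ0 : ψ 0 = 0 := by simp [ψ, H.hγ0]
  have h0Y : (0 : EuclideanSpace ℝ (Fin 1)) ∈ Y := Metric.mem_ball_self hη0
  have himg : Q '' strictTransform Y = strictTransform X := by
    unfold strictTransform
    rw [image_closure_of_isCompact hYc (hQc.mono hYK)]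
    congr 1
    ext z
    constructor
    · rintro ⟨_, ⟨v, hv, rfl⟩, rfl⟩
      rw [hQs v hv]
      refine ⟨_, ⟨hmψ hv.1, ?_⟩, rfl⟩
      intro h
      exact hv.2 (hψbij.injOn hv.1 h0Y ((mem_singleton_iff.1 h).trans hψ0.symm))
    · rintro ⟨x, hx, rfl⟩
      have hv : φ x ∈ Y \ {0} := by
        refine ⟨hmφ hx.1, ?_⟩
        intro h
        apply hx.2
        have := hinv.1 hx.1
        rw [mem_singleton_iff.1 h, hψ0] at this
        exact this.symm
      refine ⟨_, ⟨φ x, hv, rfl⟩, ?_⟩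
      rw [hQs _ hv, hinv.1 hx.1]
  have hQi' := hQi.mono hYK
  have hQbij : BijOn Q (strictTransform Y) (strictTransform X) := by
    rw [← himg]; exact hQi'.bijOn_image
  refine ⟨hφ0, hbij, hφc, ⟨ψ, hinv, hψc⟩, Function.invFunOn Q (strictTransform Y), ?_, ?_, ⟨Q, ?_, hQc.mono hYK⟩, ?_⟩
  · exact hQbij.invOn_invFunOn.symm.bijOn  hQbij.surjOn.mapsTo_invFunOn hQbij.mapsTo
  · rw [continuousOn_iff_isClosed]
    intro t ht
    refine ⟨Q '' (strictTransform Y ∩ t), ?_, ?_⟩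
    · exact ((hYc.inter_right ht).image_of_continuousOn
        ((hQc.mono hYK).mono inter_subset_left)).isClosed
    · ext z
      constructor
      · rintro ⟨h1, h2⟩
        exact ⟨⟨_, ⟨hQbij.surjOn.mapsTo_invFunOn h2, h1⟩, hQbij.invOn_invFunOn.2 h2⟩, h2⟩
      · rintro ⟨⟨w, hw, rfl⟩, h2⟩
        refine ⟨?_, h2⟩
        rw [mem_preimage, hQbij.invOn_invFunOn.1 hw.1]
        exact hw.2
  · exact hQbij.invOn_invFunOn.symm
  · intro x hx
    have hv : φ x ∈ Y \ {0} := by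
      refine ⟨hmφ hx.1, ?_⟩
      intro h
      apply hx.2
      have := hinv.1 hx.1
      rw [mem_singleton_iff.1 h, hψ0] at this
      exact this.symm
    have h1 : sphBlowup x = Q (sphBlowup (φ x)) := by rw [hQs _ hv, hinv.1 hx.1]
    rw [h1]
    exact hQbij.invOn_invFunOn.1 (subset_closure ⟨φ x, hv, rfl⟩)

lemma exists_root (hk : Odd k) : ∃ ρ : ℝ → ℝ, Continuous ρ ∧ (∀ s, (ρ s) ^ k = s) ∧
    (∀ t, ρ (t ^ k) = t) := by
  have hk0 : k ≠ 0 := by rintro rfl; exact absurd hk (by decide)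
  have hs : Function.Surjective (fun t : ℝ => t ^ k) := by
    intro s
    rcases le_total 0 s with h | h
    · exact ⟨s ^ ((k:ℝ)⁻¹), Real.rpow_inv_natCast_pow h hk0⟩
    · refine ⟨-((-s) ^ ((k:ℝ)⁻¹)), ?_⟩
      simp only
      rw [hk.neg_pow, Real.rpow_inv_natCast_pow (by linarith) hk0, neg_neg]
  let e := hk.strictMono_pow.orderIsoOfSurjective (fun t : ℝ => t ^ k) hs
  exact ⟨e.symm, e.symm.continuous, fun s => e.apply_symm_apply s, fun t => e.symm_apply_apply t⟩

lemma g_deriv (H : CurveHyp ε γ α δ k) {ρ : ℝ → ℝ} (h1 : Continuous ρ) (h2 : ∀ s, (ρ s) ^ k = s)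
    (h3 : ∀ t, ρ (t ^ k) = t) {s : ℝ} (hs : ρ s ∈ Ioo (-ε) ε) :
    HasDerivAt (fun s => s • α (ρ s)) (α (ρ s) + (ρ s / k) • deriv α (ρ s)) s := by
  have hk0 : k ≠ 0 := by have := H.hk; omega
  have hk0' : (k:ℝ) ≠ 0 := by exact_mod_cast hk0
  by_cases h0 : s = 0
  · subst h0
    have hρ0 : ρ 0 = 0 := by
      have := h3 0
      rwa [zero_pow hk0] at this
    rw [hasDerivAt_iff_tendsto_slope]
    simp only [hρ0, zero_div, zero_smul, add_zero]
    have h4 : Tendsto (fun s => α (ρ s)) (𝓝[≠] 0) (𝓝 (α 0)) := by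
      refine H.αcont0.comp ?_
      have := h1.tendsto 0
      rw [hρ0] at this
      exact this.mono_left nhdsWithin_le_nhds
    refine h4.congr' ?_
    filter_upwards [self_mem_nhdsWithin] with s hs
    have hs : s ≠ 0 := hs
    simp [slope_def_module, smul_smul, hs]
  · have ht0 : ρ s ≠ 0 := by
      intro h
      have := h2 s
      rw [h, zero_pow hk0] at this
      exact h0 this.symm
    have hd : HasDerivAt ρ ((k:ℝ) * (ρ s) ^ (k - 1))⁻¹ s :=
      HasDerivAt.of_local_left_inverse (f := fun t => t ^ k) h1.continuousAt (hasDerivAt_pow k (ρ s))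
        (mul_ne_zero hk0' (pow_ne_zero _ ht0)) (Eventually.of_forall h2)
    have hα : HasDerivAt α (deriv α (ρ s)) (ρ s) := (H.hαan _ hs).differentiableAt.hasDerivAt
    have h5 := (hasDerivAt_id s).smul (hα.scomp s hd)
    refine h5.congr_deriv ?_
    simp only [id, one_smul, smul_smul, Function.comp]
    rw [add_comm]
    congr 2
    have e : s = ρ s ^ (k - 1) * ρ s := by
      rw [← pow_succ, Nat.sub_add_cancel H.hk, h2]
    have := pow_ne_zero (k-1) ht0
    nth_rewrite 1 [e]
    field_simp

lemma g_spec (H : CurveHyp ε γ α δ k) (hk : Odd k) : ∃ (ρ : ℝ → ℝ),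
    Continuous ρ ∧ (∀ s, (ρ s) ^ k = s) ∧ (∀ t, ρ (t ^ k) = t) ∧
    ContDiffAt ℝ 1 (fun s => s • α (ρ s)) 0 ∧ HasDerivAt (fun s => s • α (ρ s)) (α 0) 0 := by
  obtain ⟨ρ, h1, h2, h3⟩ := exists_root hk
  have hρ0 : ρ 0 = 0 := by
    have := h3 0
    rwa [zero_pow (by have := H.hk; omega)] at this
  refine ⟨ρ, h1, h2, h3, ?_, ?_⟩
  · rw [contDiffAt_one_iff]
    refine ⟨fun s => ContinuousLinearMap.toSpanSingleton ℝ (α (ρ s) + (ρ s / k) • deriv α (ρ s)),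
      ρ ⁻¹' Ioo (-ε) ε, ?_, ?_, ?_⟩
    · apply (isOpen_Ioo.preimage h1).mem_nhds
      rw [mem_preimage, hρ0]; exact H.zero_mem
    · have hc : ContinuousOn (fun s => α (ρ s) + (ρ s / k) • deriv α (ρ s)) (ρ ⁻¹' Ioo (-ε) ε) := by
        have hm : MapsTo ρ (ρ ⁻¹' Ioo (-ε) ε) (Ioo (-ε) ε) := fun s hs => hs
        exact (H.αcont.comp h1.continuousOn hm).add ((h1.div_const _).continuousOn.smul
          (H.hαan.deriv.continuousOn.comp h1.continuousOn hm))
      exact (ContinuousLinearMap.toSpanSingletonCLE (𝕜 := ℝ)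
        (E := EuclideanSpace ℝ (Fin n))).continuous.comp_continuousOn hc
    · intro s hs
      exact (H.g_deriv h1 h2 h3 hs).hasFDerivAt
  · have := H.g_deriv h1 h2 h3 (s := 0) (by rw [hρ0]; exact H.zero_mem)
    simpa [hρ0] using this

lemma four_six (H : CurveHyp ε γ α δ k) (hk : Odd k) :
    LipschitzRegularToIntervalAtZero (γ '' Set.Ioo (-ε) ε) := by
  obtain ⟨ρ, h1, h2, h3, hC, hD⟩ := H.g_spec hk
  have hk0 : k ≠ 0 := by have := H.hk; omega
  have hS : HasStrictDerivAt (fun s => s • α (ρ s)) (α 0) 0 := hC.hasStrictDerivAt' hD one_ne_zero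
  have hθ := HasDerivAtFilter.isTheta_sub hS H.hα0
  obtain ⟨C1, hC1, hb1⟩ := hθ.1.exists_pos
  obtain ⟨C2, hC2, hb2⟩ := hθ.2.exists_pos
  have hev := hb1.bound.and hb2.bound
  rw [nhds_prod_eq] at hev
  obtain ⟨P, hP, hP2⟩ := mem_prod_same_iff.1 hev
  have hP' : ∀ x ∈ P, ∀ y ∈ P, _ := fun x hx y hy => hP2 (Set.mk_mem_prod hx hy)
  obtain ⟨r, hr, hrP⟩ := Metric.mem_nhds_iff.1 hP
  -- choose eta
  have hρ0 : ρ 0 = 0 := by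
    have := h3 0
    rwa [zero_pow hk0] at this
  obtain ⟨η, hη0, hηε, hηr⟩ : ∃ η, 0 < η ∧ η ≤ ε ∧ η ^ k < r := by
    have hev : ∀ᶠ η in 𝓝[>] (0:ℝ), 0 < η ∧ η ≤ ε ∧ η ^ k < r := by
      have hp : Tendsto (fun η : ℝ => η ^ k) (𝓝[>] 0) (𝓝 0) := by
        have := (continuous_pow k).tendsto (0:ℝ)
        rw [zero_pow hk0] at this
        exact this.mono_left nhdsWithin_le_nhds
      filter_upwards [self_mem_nhdsWithin, eventually_nhdsWithin_of_eventually_nhds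
        (eventually_le_nhds H.hε), hp.eventually_lt_const hr] with η a b c
      exact ⟨a, b, c⟩
    exact hev.exists
  obtain ⟨U, hU, h0U, hXU⟩ := H.exists_U hη0 hηε
  have hsub : Ioo (-η) η ⊆ Ioo (-ε) ε := Ioo_subset_Ioo (by linarith) hηε
  have hmono := hk.strictMono_pow (R := ℝ)
  refine ⟨U, hU, h0U, -(η ^ k), η ^ k, ?_, fun x => (δ x) ^ k, ?_, max 1 (max C1 C2), le_max_left _ _, ?_⟩
  · have : 0 < η ^ k := by positivity
    linarith
  · rw [hXU, ← hk.neg_pow]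
    refine ⟨?_, ?_, ?_⟩
    · rintro _ ⟨t, ht, rfl⟩
      simp only [H.hδγ t (hsub ht)]
      exact ⟨hmono ht.1, hmono ht.2⟩
    · rintro _ ⟨t, ht, rfl⟩ _ ⟨t', ht', rfl⟩ h
      simp only [H.hδγ t (hsub ht), H.hδγ t' (hsub ht')] at h
      rw [hmono.injective h]
    · intro s hs
      have hm : ρ s ∈ Ioo (-η) η := by
        constructor
        · apply hmono.lt_iff_lt.1; simp only [h2]; exact hs.1
        · apply hmono.lt_iff_lt.1; simp only [h2]; exact hs.2
      refine ⟨γ (ρ s), ⟨_, hm, rfl⟩, ?_⟩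
      simp only [H.hδγ _ (hsub hm), h2]
  · rw [hXU]
    rintro _ ⟨t, ht, rfl⟩ _ ⟨t', ht', rfl⟩
    simp only [H.hδγ t (hsub ht), H.hδγ t' (hsub ht')]
    have hb : ∀ t ∈ Ioo (-η) η, t ^ k ∈ P := by
      intro t ht
      apply hrP
      rw [mem_ball_zero_iff, Real.norm_eq_abs, abs_lt]
      have a1 := hmono ht.1
      have a2 := hmono ht.2
      simp only [hk.neg_pow] at a1 a2
      constructor <;> linarith
    obtain ⟨q1, q2⟩ := hP' _ (hb t ht) _ (hb t' ht')
    simp only [h3, ← H.hfac t (hsub ht), ← H.hfac t' (hsub ht'), ← dist_eq_norm] at q1 q2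
    set M := max 1 (max C1 C2)
    have hM : 0 < M := lt_of_lt_of_le one_pos (le_max_left _ _)
    have hM1 : C1 ≤ M := (le_max_left _ _).trans (le_max_right _ _)
    have hM2 : C2 ≤ M := (le_max_right _ _).trans (le_max_right _ _)
    constructor
    · rw [inv_mul_le_iff₀ hM]
      exact q1.trans (mul_le_mul_of_nonneg_right hM1 dist_nonneg)
    · exact q2.trans (mul_le_mul_of_nonneg_right hM2 dist_nonneg)

lemma six_four (H : CurveHyp ε γ α δ k)
    (h : LipschitzRegularToIntervalAtZero (γ '' Set.Ioo (-ε) ε)) : Odd k := by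
  by_contra hk
  rw [Nat.not_odd_iff_even] at hk
  obtain ⟨U, hU, h0U, a, b, hab, f, hf, K, hK, hL⟩ := h
  have hK0 : 0 < K := by linarith
  obtain ⟨r, hr, hball⟩ := Metric.eventually_nhds_iff_ball.1
    ((H.γcont0.eventually (hU.mem_nhds h0U)).and H.I_nhds)
  rw [Real.ball_eq_Ioo, zero_sub, zero_add] at hball
  have hm : ∀ t ∈ Ioo (-r) r, γ t ∈ γ '' Ioo (-ε) ε ∩ U := fun t ht =>
    ⟨⟨t, (hball t ht).2, rfl⟩, (hball t ht).1⟩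
  have hfc : ContinuousOn f (γ '' Ioo (-ε) ε ∩ U) := by
    have : LipschitzOnWith ⟨K, hK0.le⟩ f (γ '' Ioo (-ε) ε ∩ U) :=
      LipschitzOnWith.of_dist_le_mul fun x hx y hy => (hL x hx y hy).2
    exact this.continuousOn
  have hc : ContinuousOn (f ∘ γ) (Ioo (-r) r) :=
    hfc.comp (H.γcont.mono fun t ht => (hball t ht).2) hm
  have hi : InjOn (f ∘ γ) (Ioo (-r) r) := by
    intro t ht t' ht' h
    exact H.hinj (hball t ht).2 (hball t' ht').2 (hf.injOn (hm t ht) (hm t' ht') h)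
  have hmon := hc.strictMonoOn_of_injOn_Ioo (by linarith) hi
  have hkey : ∀ t ∈ Ioo 0 r, dist (f (γ t)) (f (γ 0)) ≤ dist (f (γ t)) (f (γ (-t))) := by
    intro t ht
    have m1 : t ∈ Ioo (-r) r := ⟨by linarith [ht.1, ht.2], ht.2⟩
    have m2 : (0:ℝ) ∈ Ioo (-r) r := ⟨by linarith, hr⟩
    have m3 : -t ∈ Ioo (-r) r := ⟨by linarith [ht.1, ht.2], by linarith [ht.1, ht.2]⟩
    have n1 : -t < 0 := by linarith [ht.1]
    rw [Real.dist_eq, Real.dist_eq]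
    rcases hmon with hmon | hmon
    · have := hmon m3 m2 n1
      have := hmon m2 m1 ht.1
      simp only [Function.comp] at *
      rw [abs_of_pos (by linarith), abs_of_pos (by linarith)]; linarith
    · have := hmon m3 m2 n1
      have := hmon m2 m1 ht.1
      simp only [Function.comp] at *
      rw [abs_of_neg (by linarith), abs_of_neg (by linarith)]; linarith
  have hineq : ∀ t ∈ Ioo 0 r, K⁻¹ * ‖α t‖ ≤ K * ‖α t - α (-t)‖ := by
    intro t ht
    have m1 : t ∈ Ioo (-r) r := ⟨by linarith [ht.1, ht.2], ht.2⟩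
    have m2 : (0:ℝ) ∈ Ioo (-r) r := ⟨by linarith, hr⟩
    have m3 : -t ∈ Ioo (-r) r := ⟨by linarith [ht.1, ht.2], by linarith [ht.1, ht.2]⟩
    have := ((hL _ (hm t m1) _ (hm 0 m2)).1.trans (hkey t ht)).trans (hL _ (hm t m1) _ (hm _ m3)).2
    have hp : 0 < t ^ k := pow_pos ht.1 k
    rw [H.hγ0, dist_zero_right, dist_eq_norm, H.hfac t (hball t m1).2, H.hfac _ (hball _ m3).2,
      hk.neg_pow, ← smul_sub, norm_smul, norm_smul, Real.norm_of_nonneg hp.le] at this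
    nlinarith
  have hid : Tendsto (fun s : ℝ => s) (𝓝[>] 0) (𝓝 0) := tendsto_id.mono_left nhdsWithin_le_nhds
  have hneg : Tendsto (fun s : ℝ => -s) (𝓝[>] 0) (𝓝 0) := by simpa using hid.neg
  have l1 : Tendsto (fun t => K⁻¹ * ‖α t‖) (𝓝[>] 0) (𝓝 (K⁻¹ * ‖α 0‖)) :=
    (H.αcont0.comp hid).norm.const_mul _
  have l2 : Tendsto (fun t => K * ‖α t - α (-t)‖) (𝓝[>] 0) (𝓝 (K * ‖α 0 - α 0‖)) :=
    ((H.αcont0.comp hid).sub (H.αcont0.comp hneg)).norm.const_mul _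
  have := le_of_tendsto_of_tendsto l1 l2 (by
    filter_upwards [Ioo_mem_nhdsGT hr] with t ht using hineq t ht)
  rw [sub_self, norm_zero, mul_zero] at this
  have h0 : 0 < ‖α 0‖ := norm_pos_iff.2 H.hα0
  have : 0 < K⁻¹ * ‖α 0‖ := by positivity
  linarith

lemma four_five (H : CurveHyp ε γ α δ k) (hk : Odd k) :
    IsC1RegularAtZero (γ '' Set.Ioo (-ε) ε) := by
  obtain ⟨ρ, h1, h2, h3, hC, hD⟩ := H.g_spec hk
  have hk0 : k ≠ 0 := by have := H.hk; omega
  have hρ0 : ρ 0 = 0 := by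
    have := h3 0
    rwa [zero_pow hk0] at this
  have hn : 0 < n := by
    rcases Nat.eq_zero_or_pos n with h | h
    · subst h
      exact absurd (Subsingleton.elim _ _) H.hα0
    · exact h
  let i0 : Fin n := ⟨0, hn⟩
  let e0 : EuclideanSpace ℝ (Fin n) := EuclideanSpace.single i0 1
  have he0 : e0 ≠ 0 := by
    intro h
    have := congrArg (fun v : EuclideanSpace ℝ (Fin n) => v i0) h
    simp [e0] at this
  have he0i : ∀ s : ℝ, (s • e0) i0 = s := by intro s; simp [e0]
  obtain ⟨A, hA⟩ := SeparatingDual.exists_continuousLinearEquiv_apply_eq (R := ℝ) he0 H.hα0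
  let g : ℝ → EuclideanSpace ℝ (Fin n) := fun s => s • α (ρ s)
  have hgγ : ∀ t ∈ Ioo (-ε) ε, g (t ^ k) = γ t := by
    intro t ht
    simp only [g, h3, H.hfac t ht]
  let pr : EuclideanSpace ℝ (Fin n) →L[ℝ] ℝ := EuclideanSpace.proj i0
  have hpr : ∀ y, pr y = y i0 := fun y => rfl
  let Θ : EuclideanSpace ℝ (Fin n) → EuclideanSpace ℝ (Fin n) :=
    fun y => A y + (g (pr y) - pr y • α 0)
  have hΘe : ∀ s : ℝ, Θ (s • e0) = g s := by
    intro s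
    simp only [Θ, hpr, he0i, map_smul, hA]
    abel
  have hpr0 : pr 0 = 0 := map_zero pr
  have hΘ0 : Θ 0 = 0 := by simp [Θ, g]
  have hΘC : ContDiffAt ℝ 1 Θ 0 := by
    refine A.contDiff.contDiffAt.add (ContDiffAt.sub ?_ ?_)
    · refine ContDiffAt.comp (0 : EuclideanSpace ℝ (Fin n)) (g := g) ?_ pr.contDiff.contDiffAt
      rw [hpr0]; exact hC
    · exact pr.contDiff.contDiffAt.smul contDiffAt_const
  have hΘD : HasFDerivAt Θ (A : EuclideanSpace ℝ (Fin n) →L[ℝ] EuclideanSpace ℝ (Fin n)) 0 := by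
    have d1 : HasFDerivAt (fun y => g (pr y)) ((ContinuousLinearMap.toSpanSingleton ℝ (α 0)).comp pr) 0 := by
      have : HasFDerivAt g (ContinuousLinearMap.toSpanSingleton ℝ (α 0)) (pr 0) := by
        rw [hpr0]; exact hD.hasFDerivAt
      exact this.comp 0 pr.hasFDerivAt
    have d2 : HasFDerivAt (fun y => pr y • α 0) ((ContinuousLinearMap.toSpanSingleton ℝ (α 0)).comp pr) 0 :=
      ((ContinuousLinearMap.toSpanSingleton ℝ (α 0)).comp pr).hasFDerivAt
    have := A.hasFDerivAt (x := 0) |>.add (d1.sub d2)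
    rwa [sub_self, add_zero] at this
  let e := hΘC.toOpenPartialHomeomorph Θ hΘD one_ne_zero
  have hes : (0 : EuclideanSpace ℝ (Fin n)) ∈ e.source :=
    hΘC.mem_toOpenPartialHomeomorph_source hΘD one_ne_zero
  have hee : ∀ y, e y = Θ y := fun y => rfl
  have het : (0 : EuclideanSpace ℝ (Fin n)) ∈ e.target := by
    have := e.map_source hes
    rwa [hee, hΘ0] at this
  have hsymm0 : e.symm 0 = 0 := by
    have := e.left_inv hes
    rwa [hee, hΘ0] at this
  have hinvC : ContDiffAt ℝ 1 e.symm 0 := by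
    refine e.contDiffAt_symm (f₀' := A) het ?_ ?_
    · rw [hsymm0]; exact hΘD
    · rw [hsymm0]; exact hΘC
  -- neighbourhoods of smoothness
  obtain ⟨V1, hV1, hV1o, h0V1⟩ := eventually_nhds_iff.1 (hΘC.eventually (by simp))
  obtain ⟨W1, hW1, hW1o, h0W1⟩ := eventually_nhds_iff.1 (hinvC.eventually (by simp))
  -- V : the source side
  let V : Set (EuclideanSpace ℝ (Fin n)) := e.source ∩ (V1 ∩ (fun y => ρ (pr y)) ⁻¹' Ioo (-ε) ε)
  have hVo : IsOpen V := e.open_source.inter (hV1o.inter (isOpen_Ioo.preimage (h1.comp pr.continuous)))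
  have h0V : (0 : EuclideanSpace ℝ (Fin n)) ∈ V :=
    ⟨hes, h0V1, by simpa [hpr0, hρ0] using H.hε⟩
  -- choose eta such that the corresponding axis points are in V
  obtain ⟨η, hη0, hηε, hηV⟩ : ∃ η, 0 < η ∧ η ≤ ε ∧ ∀ t ∈ Ioo (-η) η, t ^ k • e0 ∈ V := by
    have hc : Tendsto (fun t : ℝ => t ^ k • e0) (𝓝 0) (𝓝 0) := by
      have : Continuous (fun t : ℝ => t ^ k • e0) := by fun_prop
      have := this.tendsto 0
      rwa [zero_pow hk0, zero_smul] at this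
    obtain ⟨r, hr, hb⟩ := Metric.eventually_nhds_iff_ball.1 (hc.eventually (hVo.mem_nhds h0V))
    rw [Real.ball_eq_Ioo, zero_sub, zero_add] at hb
    refine ⟨min r ε, lt_min hr H.hε, min_le_right _ _, fun t ht => hb t ?_⟩
    exact ⟨by linarith [ht.1, min_le_left r ε], by linarith [ht.2, min_le_left r ε]⟩
  obtain ⟨U, hU, h0U, hXU⟩ := H.exists_U hη0 hηε
  let W : Set (EuclideanSpace ℝ (Fin n)) := (e.target ∩ e.symm ⁻¹' V) ∩ (U ∩ W1)
  have hWo : IsOpen W := (e.isOpen_inter_preimage_symm hVo).inter (hU.inter hW1o)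
  have h0W : (0 : EuclideanSpace ℝ (Fin n)) ∈ W :=
    ⟨⟨het, by rw [mem_preimage, hsymm0]; exact h0V⟩, h0U, h0W1⟩
  have hWt : W ⊆ e.target := fun x hx => hx.1.1
  have hWimg : e.symm '' W = e.source ∩ e ⁻¹' W := e.symm_image_eq_source_inter_preimage hWt
  have hWimgV : e.symm '' W ⊆ V := by
    rintro _ ⟨x, hx, rfl⟩; exact hx.1.2
  refine ⟨W, hWo, h0W, 1, ?_⟩
  rintro p ⟨hpΓ, hpW⟩
  refine ⟨W, e.symm, hWo, hpW, ?_, ?_, ⟨Θ, ⟨?_, ?_⟩, ?_⟩, ?_⟩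
  · rw [hWimg]; exact e.isOpen_inter_preimage hWo
  · exact fun x hx => (hW1 x hx.2.2).contDiffWithinAt
  · intro x hx
    exact e.right_inv (hWt hx)
  · rintro _ ⟨x, hx, rfl⟩
    exact congrArg e.symm (e.right_inv (hWt hx))
  · intro y hy
    exact (hV1 y (hWimgV hy).2.1).contDiffWithinAt
  · ext y
    constructor
    · rintro ⟨x, ⟨⟨hxΓ, hxW⟩, -⟩, rfl⟩
      refine ⟨⟨x, hxW, rfl⟩, ?_⟩
      have hx : x ∈ γ '' Ioo (-η) η := by rw [← hXU]; exact ⟨hxΓ, hxW.2.1⟩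
      obtain ⟨t, ht, rfl⟩ := hx
      have ht' : t ∈ Ioo (-ε) ε := ⟨by linarith [ht.1], by linarith [ht.2]⟩
      have : e.symm (γ t) = t ^ k • e0 := by
        rw [← hgγ t ht', ← hΘe]
        exact e.left_inv (hηV t ht).1
      rw [this]
      intro i hi
      have hne : i ≠ i0 := by
        intro h; rw [h] at hi; simp [i0] at hi
      simp [e0, hne]
    · rintro ⟨⟨x, hxW, rfl⟩, hy⟩
      refine ⟨x, ⟨⟨?_, hxW⟩, hxW⟩, rfl⟩
      set y := e.symm x with hydef
      have hyV : y ∈ V := hxW.1.2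
      have hye : y = pr y • e0 := by
        ext i
        by_cases h : i = i0
        · rw [h, he0i]; rfl
        · have : (1:ℕ) ≤ (i:ℕ) := by
            by_contra h'
            apply h
            apply Fin.ext
            simp only [i0]; omega
          rw [hy i this]
          simp [e0, h]
      have hxy : x = Θ y := (e.right_inv (hWt hxW)).symm
      rw [hxy, hye, hΘe]
      refine ⟨ρ (pr y), hyV.2.2, ?_⟩
      rw [← hgγ _ hyV.2.2, h2]

lemma five_four (H : CurveHyp ε γ α δ k)
    (h : IsC1RegularAtZero (γ '' Set.Ioo (-ε) ε)) : Odd k := by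
  by_contra hk
  rw [Nat.not_odd_iff_even] at hk
  obtain ⟨U, hU, h0U, d, hS⟩ := h
  obtain ⟨W, Φ, hW, h0W, hΦW, hΦ, ⟨Ψ, hinv, hΨ⟩, himg⟩ := hS 0 ⟨H.zero_memΓ, h0U⟩
  have hq : Φ 0 ∈ Φ '' W := ⟨0, h0W, rfl⟩
  have hΨ0 : Ψ (Φ 0) = 0 := hinv.1 h0W
  have hqd : ∀ i : Fin n, d ≤ (i:ℕ) → (Φ 0) i = 0 := by
    have : Φ 0 ∈ Φ '' (γ '' Ioo (-ε) ε ∩ U ∩ W) := ⟨0, ⟨⟨H.zero_memΓ, h0U⟩, h0W⟩, rfl⟩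
    rw [himg] at this
    exact this.2
  -- d is positive and n is positive
  have hdn : ∃ i : Fin n, (i:ℕ) < d := by
    by_contra hcon
    push Not at hcon
    have hev : ∀ᶠ t in 𝓝[≠] (0:ℝ), t ∈ Ioo (-ε) ε ∧ γ t ∈ U ∧ γ t ∈ W ∧ t ≠ 0 := by
      filter_upwards [eventually_nhdsWithin_of_eventually_nhds H.I_nhds,
        eventually_nhdsWithin_of_eventually_nhds (H.γcont0 (hU.mem_nhds h0U)),
        eventually_nhdsWithin_of_eventually_nhds (H.γcont0 (hW.mem_nhds h0W)),
        self_mem_nhdsWithin] with t h1 h2 h4 h3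
      exact ⟨h1, h2, h4, h3⟩
    obtain ⟨t, ht, htU, htW, ht0⟩ := hev.exists
    have : Φ (γ t) ∈ Φ '' (γ '' Ioo (-ε) ε ∩ U ∩ W) := ⟨_, ⟨⟨⟨t, ht, rfl⟩, htU⟩, htW⟩, rfl⟩
    rw [himg] at this
    have heq : Φ (γ t) = Φ 0 := by
      ext i
      rw [this.2 i (hcon i), hqd i (hcon i)]
    have := hinv.1 htW
    rw [heq, hΨ0] at this
    exact H.γne ht ht0 this.symm
  obtain ⟨i0, hi0⟩ := hdn
  let e0 : EuclideanSpace ℝ (Fin n) := EuclideanSpace.single i0 1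
  have he0 : e0 ≠ 0 := by
    intro h
    have := congrArg (fun v : EuclideanSpace ℝ (Fin n) => v i0) h
    simp [e0] at this
  have hΨd : HasFDerivAt Ψ (fderiv ℝ Ψ (Φ 0)) (Φ 0) :=
    ((hΨ.contDiffAt (hΦW.mem_nhds hq)).differentiableAt one_ne_zero).hasFDerivAt
  have hΦd : HasFDerivAt Φ (fderiv ℝ Φ 0) (Ψ (Φ 0)) := by
    rw [hΨ0]
    exact ((hΦ.contDiffAt (hW.mem_nhds h0W)).differentiableAt one_ne_zero).hasFDerivAt
  have hcomp : fderiv ℝ Φ 0 (fderiv ℝ Ψ (Φ 0) e0) = e0 := by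
    have d1 := hΦd.comp (Φ 0) hΨd
    have d2 : HasFDerivAt (Φ ∘ Ψ) (ContinuousLinearMap.id ℝ _) (Φ 0) := by
      refine (hasFDerivAt_id (Φ 0)).congr_of_eventuallyEq ?_
      filter_upwards [hΦW.mem_nhds hq] with y hy
      exact hinv.2 hy
    have := d1.unique d2
    exact congrArg (fun L => L e0) this
  set v := fderiv ℝ Ψ (Φ 0) e0 with hv
  have hv0 : v ≠ 0 := by
    intro h
    rw [h, map_zero] at hcomp
    exact he0 hcomp.symm
  have key : ∀ σ : ℝ, σ ≠ 0 → σ • v ∈ tangentConeAtZero (γ '' Ioo (-ε) ε) := by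
    intro σ hσ
    have hline : HasDerivAt (fun s : ℝ => Φ 0 + s • (σ • e0)) (σ • e0) 0 := by
      have := ((hasDerivAt_id (0:ℝ)).smul_const (σ • e0)).const_add (Φ 0)
      simpa using this
    have hline0 : Φ 0 + (0:ℝ) • (σ • e0) = Φ 0 := by simp
    have hcd : HasDerivAt (fun s : ℝ => Ψ (Φ 0 + s • (σ • e0))) (σ • v) 0 := by
      have h' : HasFDerivAt Ψ (fderiv ℝ Ψ (Φ 0)) (Φ 0 + (0:ℝ) • (σ • e0)) := by
        rw [hline0]; exact hΨd
      have := h'.comp_hasDerivAt (0:ℝ) hline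
      rwa [map_smul] at this
    have hmem : ∀ᶠ s in 𝓝[>] (0:ℝ), Φ 0 + s • (σ • e0) ∈ Φ '' W := by
      have := hline.continuousAt.tendsto
      rw [hline0] at this
      exact (this.mono_left nhdsWithin_le_nhds).eventually (hΦW.mem_nhds hq)
    refine cone_mem (fun s : ℝ => Ψ (Φ 0 + s • (σ • e0))) id ?_ ?_ self_mem_nhdsWithin ?_
    · filter_upwards [hmem, self_mem_nhdsWithin] with s hs hs0
      have hs0 : 0 < s := hs0
      have h1 : Φ 0 + s • (σ • e0) ∈ Φ '' (γ '' Ioo (-ε) ε ∩ U ∩ W) := by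
        rw [himg]
        refine ⟨hs, fun i hi => ?_⟩
        have hne : i ≠ i0 := by intro h; rw [h] at hi; omega
        simp [hqd i hi, e0, hne]
      obtain ⟨x, hx, hxe⟩ := h1
      have hΨx : Ψ (Φ 0 + s • (σ • e0)) = x := by rw [← hxe]; exact hinv.1 hx.2
      rw [hΨx]
      refine ⟨hx.1.1, ?_⟩
      intro hx0
      rw [mem_singleton_iff.1 hx0] at hxe
      have : s • (σ • e0) = 0 := by simpa using hxe.symm
      exact smul_ne_zero hs0.ne' (smul_ne_zero hσ he0) this
    · have := hcd.continuousAt.tendsto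
      rw [hline0, hΨ0] at this
      exact this.mono_left nhdsWithin_le_nhds
    · have := (hasDerivAt_iff_tendsto_slope.1 hcd).mono_left
        (nhdsWithin_mono (0:ℝ) (fun s (hs : 0 < s) => hs.ne' : Ioi (0:ℝ) ⊆ {0}ᶜ))
      refine this.congr fun s => ?_
      simp [slope_def_module, hΨ0]
  obtain ⟨c, hc, hc0⟩ := H.cone_sub (key 1 one_ne_zero)
  obtain ⟨c', hc', hc0'⟩ := H.cone_sub (key (-1) (by norm_num))
  have hsum : (c + c') • α 0 = 0 := by
    rw [add_smul, ← hc, ← hc']; simp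
  have := (smul_eq_zero.1 hsum).resolve_right H.hα0
  have h0 := hc0 hk
  have h0' := hc0' hk
  have : c = 0 := by linarith
  rw [this, zero_smul, one_smul] at hc
  exact hv0 hc

end CurveHyp

/-- For a real analytic curve germ `γ` of order `k` at `0` which is a
homeomorphism onto its image `Γ`, the following are equivalent: (1) `Γ` is
blow-spherical regular at `0`; (2) `C(Γ,0)` is homeomorphic to `ℝ`; (3) `C(Γ,0)` is a
real line; (4) `k` is odd; (5) `Γ` is `C¹` regular at `0`; (6) `Γ` is Lipschitz
regular at `0`. -/
theorem stmt3 {n : ℕ} (ε : ℝ) (hε : 0 < ε)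
    (γ α : ℝ → EuclideanSpace ℝ (Fin n)) (k : ℕ) (hk : 1 ≤ k)
    (hγan : AnalyticOnNhd ℝ γ (Set.Ioo (-ε) ε))
    (hγ0 : γ 0 = 0)
    (hγne : ¬ ∀ t ∈ Set.Ioo (-ε) ε, γ t = 0)
    (hinj : Set.InjOn γ (Set.Ioo (-ε) ε))
    (hhomeo : ∃ δ : EuclideanSpace ℝ (Fin n) → ℝ,
      ContinuousOn δ (γ '' Set.Ioo (-ε) ε) ∧ ∀ t ∈ Set.Ioo (-ε) ε, δ (γ t) = t)
    (hαan : AnalyticOnNhd ℝ α (Set.Ioo (-ε) ε))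
    (hα0 : α 0 ≠ 0)
    (hfac : ∀ t ∈ Set.Ioo (-ε) ε, γ t = t ^ k • α t) :
    [ BlowSphericalRegularAtZero (γ '' Set.Ioo (-ε) ε),
      Nonempty (↥(tangentConeAtZero (γ '' Set.Ioo (-ε) ε)) ≃ₜ ℝ),
      (∃ v : EuclideanSpace ℝ (Fin n), v ≠ 0 ∧
        tangentConeAtZero (γ '' Set.Ioo (-ε) ε) = Set.range (fun t : ℝ => t • v)),
      Odd k,
      IsC1RegularAtZero (γ '' Set.Ioo (-ε) ε),
      LipschitzRegularToIntervalAtZero (γ '' Set.Ioo (-ε) ε) ].TFAE := by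
  obtain ⟨δ, hδ, hδγ⟩ := hhomeo
  have H : CurveHyp ε γ α δ k := ⟨hε, hk, hγ0, hinj, hδ, hδγ, hαan, hα0, hfac⟩
  tfae_have 4 → 3 := H.four_three
  tfae_have 3 → 2 := CurveHyp.three_two
  tfae_have 2 → 4 := H.two_four
  tfae_have 1 → 4 := H.one_four
  tfae_have 4 → 1 := H.four_one
  tfae_have 4 → 5 := H.four_five
  tfae_have 5 → 4 := H.five_four
  tfae_have 4 → 6 := H.four_six
  tfae_have 6 → 4 := H.six_four
  tfae_finish
end

section
/- Let X ⊆ ℝⁿ with 0 ∈ X, and suppose there are ε > 0, an open neighborhood U of 0, and finitely many real analytic maps γ_1, …, γ_r : (−ε, ε) → ℝⁿ, each not identically zero, with γ_i(0) = 0, each γ_i a homeomorphism onto its image Γ_i := γ_i((−ε, ε)), Γ_i ∩ Γ_j = {0} for i ≠ j, and X ∩ U = Γ_1 ∪ ⋯ ∪ Γ_r (every real analytic curve admits such a decomposition into analytic branches). Then X is blow-spherical regular at 0 if and only if X is C¹ regular at 0. -/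
open Filter Set Topology

theorem invFunOn_contOn {A B : Type*} [TopologicalSpace A] [TopologicalSpace B] [T2Space B]
    {C : Set A} (hC : IsCompact C) {H : A → B} (hH : ContinuousOn H C)
    {G : B → A} (hG : ∀ a ∈ C, G (H a) = a) : ContinuousOn G (H '' C) := by
  rw [continuousOn_iff_isClosed]
  intro t ht
  refine ⟨H '' (t ∩ C), ?_, ?_⟩
  · exact ((hC.inter_left ht).image_of_continuousOn (hH.mono inter_subset_right)).isClosed
  · ext b
    constructor
    · rintro ⟨hb, a, ha, rfl⟩
      have : G (H a) ∈ t := hb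
      rw [hG a ha] at this
      exact ⟨⟨a, ⟨this, ha⟩, rfl⟩, a, ha, rfl⟩
    · rintro ⟨⟨a, ⟨hat, ha⟩, rfl⟩, -⟩
      refine ⟨?_, a, ha, rfl⟩
      show G (H a) ∈ t
      rwa [hG a ha]

theorem coreA {E F : Type*} [NormedAddCommGroup E] [NormedSpace ℝ E]
    [NormedAddCommGroup F] [NormedSpace ℝ F] [FiniteDimensional ℝ F]
    (ψ : F → E) (φ : E → F) (B : F →L[ℝ] E) (hB : HasFDerivAt ψ B 0) (hψ0 : ψ 0 = 0)
    (hBinj : Function.Injective B) (R : ℝ) (hR : 0 < R)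
    (hψ : ContinuousOn ψ (Metric.closedBall 0 R))
    (hφψ : ∀ y ∈ Metric.closedBall (0 : F) R, φ (ψ y) = y)
    (hφ : ContinuousOn φ (ψ '' Metric.ball 0 R)) :
    IsBlowSphericalHomeo (ψ '' Metric.ball (0 : F) R) (Metric.ball (0 : F) R) φ := by
  have hbc : Metric.ball (0 : F) R ⊆ Metric.closedBall 0 R := Metric.ball_subset_closedBall
  have h0c : (0 : F) ∈ Metric.closedBall (0 : F) R := by simp [hR.le]
  have hφ0 : φ 0 = 0 := by
    have := hφψ 0 h0c
    rwa [hψ0] at this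
  have hψne : ∀ y ∈ Metric.closedBall (0 : F) R, y ≠ 0 → ψ y ≠ 0 := by
    intro y hy hy0 h
    apply hy0
    rw [← hφψ y hy, h, hφ0]
  set K : Set (F × ℝ) := Metric.sphere (0 : F) 1 ×ˢ Icc 0 R with hK
  have hKc : IsCompact K := (isCompact_sphere 0 1).prod isCompact_Icc
  set D : Set (F × ℝ) := sphBlowup '' (Metric.ball (0 : F) R \ {0}) with hD
  have hDK : D ⊆ K := by
    rintro _ ⟨y, ⟨hy, hy0⟩, rfl⟩
    have : ‖y‖ ≠ 0 := by simpa using hy0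
    refine ⟨?_, ?_⟩
    · simp [sphBlowup, norm_smul, this]
    · simp only [sphBlowup]
      have := mem_ball_zero_iff.1 hy
      exact ⟨norm_nonneg _, this.le⟩
  have hcDK : closure D ⊆ K := closure_minimal hDK hKc.isClosed
  have hcDc : IsCompact (closure D) := hKc.of_isClosed_subset isClosed_closure hcDK
  classical
  set G : F × ℝ → E := fun p => if p.2 = 0 then B p.1 else p.2⁻¹ • ψ (p.2 • p.1) with hG
  have hball : ∀ p ∈ K, p.2 • p.1 ∈ Metric.closedBall (0 : F) R := by
    rintro ⟨v, s⟩ ⟨hv, hs⟩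
    simp only [mem_sphere_zero_iff_norm] at hv
    simp only [mem_closedBall_zero_iff, norm_smul, hv, mul_one, Real.norm_eq_abs, abs_of_nonneg hs.1]
    exact hs.2
  have hGne : ∀ p ∈ K, G p ≠ 0 := by
    rintro ⟨v, s⟩ hp
    have hv : ‖v‖ = 1 := by simpa using hp.1
    have hv0 : v ≠ 0 := by
      rintro rfl
      simp at hv
    by_cases hs : s = 0
    · simp only [hG, hs, if_true]
      intro h
      exact hv0 (hBinj (by rw [h, map_zero]))
    · simp only [hG, hs, if_false]
      exact smul_ne_zero (inv_ne_zero hs) (hψne _ (hball _ hp) (smul_ne_zero hs hv0))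
  have hGc : ContinuousOn G K := by
    rintro ⟨v, s⟩ hp
    by_cases hs : s = 0
    · subst hs
      have hv : ‖v‖ = 1 := by simpa using hp.1
      have hmain : Tendsto (fun p : F × ℝ => G p - B p.1) (𝓝[K] (v, 0)) (𝓝 0) := by
        rw [Metric.tendsto_nhds]
        intro e he
        have h1 := hB.isLittleO
        rw [Asymptotics.isLittleO_iff] at h1
        have h2 := h1 (c := e / 2) (by positivity)
        have h3 : Tendsto (fun p : F × ℝ => p.2 • p.1) (𝓝[K] (v, 0)) (𝓝 0) := by
          have : Continuous (fun p : F × ℝ => p.2 • p.1) := by fun_prop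
          have := this.tendsto (v, 0)
          simp only [zero_smul] at this
          exact this.mono_left nhdsWithin_le_nhds
        filter_upwards [h3.eventually h2, self_mem_nhdsWithin] with p hp1 hpK
        have hpv : ‖p.1‖ = 1 := by simpa using hpK.1
        simp only [dist_zero_right]
        by_cases hp2 : p.2 = 0
        · simp [hG, hp2, he]
        · simp only [hG, hp2, if_false]
          have : p.2⁻¹ • ψ (p.2 • p.1) - B p.1 = p.2⁻¹ • (ψ (p.2 • p.1) - ψ 0 - B (p.2 • p.1 - 0)) := by
            simp [hψ0, smul_sub, smul_smul, hp2]
          rw [this, norm_smul]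
          have hpos : 0 < |p.2| := abs_pos.2 hp2
          rw [sub_zero (p.2 • p.1), norm_smul, hpv, mul_one, Real.norm_eq_abs] at hp1
          rw [sub_zero (p.2 • p.1), norm_inv, Real.norm_eq_abs]
          calc |p.2|⁻¹ * _ ≤ |p.2|⁻¹ * (e / 2 * |p.2|) := by gcongr
            _ = e / 2 := by field_simp
            _ < e := by linarith
      have h4 : Tendsto (fun p : F × ℝ => B p.1) (𝓝[K] (v, 0)) (𝓝 (B v)) := by
        have : Continuous (fun p : F × ℝ => B p.1) := by fun_prop
        exact (this.tendsto (v, 0)).mono_left nhdsWithin_le_nhds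
      have h5 := hmain.add h4
      simp only [sub_add_cancel, zero_add] at h5
      show Tendsto _ _ _
      simpa [hG] using h5
    · have h1 : ContinuousOn (fun p : F × ℝ => p.2⁻¹ • ψ (p.2 • p.1)) (K ∩ {p | p.2 ≠ 0}) := by
        apply ContinuousOn.smul
        · exact ContinuousOn.inv₀ (by fun_prop) (fun p hp => hp.2)
        · exact hψ.comp (by fun_prop) (fun p hp => hball p hp.1)
      have h2 : ContinuousOn G (K ∩ {p | p.2 ≠ 0}) := h1.congr (fun p hp => by
        have : p.2 ≠ 0 := hp.2
        simp [hG, this])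
      refine (h2 (v, s) ⟨hp, hs⟩).mono_of_mem_nhdsWithin ?_
      apply inter_mem_nhdsWithin
      exact (isOpen_ne_fun continuous_snd continuous_const).mem_nhds hs
  set H : F × ℝ → E × ℝ := fun p => (‖G p‖⁻¹ • G p, p.2 * ‖G p‖) with hH
  have hHc : ContinuousOn H K := by
    apply ContinuousOn.prodMk
    · exact (ContinuousOn.inv₀ hGc.norm (fun p hp => norm_ne_zero_iff.2 (hGne p hp))).smul hGc
    · exact continuousOn_snd.mul hGc.norm
  have hinj : InjOn H K := by
    rintro ⟨v, s⟩ hp ⟨w, u⟩ hq h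
    have hv : ‖v‖ = 1 := by simpa using hp.1
    have hw : ‖w‖ = 1 := by simpa using hq.1
    have hn1 : 0 < ‖G (v, s)‖ := norm_pos_iff.2 (hGne _ hp)
    have hn2 : 0 < ‖G (w, u)‖ := norm_pos_iff.2 (hGne _ hq)
    have hs0 : 0 ≤ s := hp.2.1
    have hu0 : 0 ≤ u := hq.2.1
    simp only [hH, Prod.mk.injEq] at h
    obtain ⟨h1, h2⟩ := h
    have hsu : s = 0 ↔ u = 0 := by
      constructor
      · rintro rfl
        rw [zero_mul] at h2
        exact (mul_eq_zero.1 h2.symm).resolve_right hn2.ne'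
      · rintro rfl
        rw [zero_mul] at h2
        exact (mul_eq_zero.1 h2).resolve_right hn1.ne'
    by_cases hs : s = 0
    · have hu := hsu.1 hs
      subst hs hu
      simp only [hG, if_true] at h1 hn1 hn2
      rw [← map_smul, ← map_smul] at h1
      have h3 := hBinj h1
      have h4 : ‖B v‖⁻¹ = ‖B w‖⁻¹ := by
        have := congrArg norm h3
        simpa [norm_smul, hv, hw] using this
      rw [h4] at h3
      have := smul_right_injective F (inv_ne_zero hn2.ne') h3
      rw [this]
    · have hu : u ≠ 0 := fun h => hs (hsu.2 h)
      have e1 : ∀ (z : F) (a : ℝ), a ≠ 0 → a • G (z, a) = ψ (a • z) := by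
        intro z a ha
        simp [hG, ha, smul_smul]
      have h3 : s • G (v, s) = u • G (w, u) := by
        have a1 : s • G (v, s) = (s * ‖G (v, s)‖) • (‖G (v, s)‖⁻¹ • G (v, s)) := by
          rw [smul_smul, mul_assoc, mul_inv_cancel₀ hn1.ne', mul_one]
        have a2 : u • G (w, u) = (u * ‖G (w, u)‖) • (‖G (w, u)‖⁻¹ • G (w, u)) := by
          rw [smul_smul, mul_assoc, mul_inv_cancel₀ hn2.ne', mul_one]
        rw [a1, a2, h1, h2]
      rw [e1 _ _ hs, e1 _ _ hu] at h3
      have h4 : s • v = u • w := by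
        rw [← hφψ _ (hball _ hp), ← hφψ _ (hball _ hq)]
        exact congrArg φ h3
      have h5 : s = u := by
        have := congrArg norm h4
        simpa [norm_smul, hv, hw, abs_of_nonneg hs0, abs_of_nonneg hu0] using this
      subst h5
      rw [smul_right_injective F hs h4]
  have hHs : ∀ y : F, y ≠ 0 → H (sphBlowup y) = sphBlowup (ψ y) := by
    intro y hy
    have hy' : ‖y‖ ≠ 0 := norm_ne_zero_iff.2 hy
    simp only [hH, hG, sphBlowup, hy', if_false, smul_smul, mul_inv_cancel₀ hy', one_smul,
      norm_smul, norm_inv, norm_norm]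
    simp only [mul_inv, inv_inv, Prod.mk.injEq]
    constructor
    · congr 1
      field_simp
    · field_simp
  have hST : strictTransform (ψ '' Metric.ball (0 : F) R) = H '' closure D := by
    rw [image_closure_of_isCompact hcDc (hHc.mono hcDK)]
    unfold strictTransform
    congr 1
    ext q
    constructor
    · rintro ⟨_, ⟨⟨y, hy, rfl⟩, hy0⟩, rfl⟩
      have : y ≠ 0 := by
        rintro rfl
        exact hy0 hψ0
      exact ⟨_, ⟨y, ⟨hy, this⟩, rfl⟩, hHs y this⟩
    · rintro ⟨_, ⟨y, ⟨hy, hy0⟩, rfl⟩, rfl⟩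
      exact ⟨ψ y, ⟨⟨y, hy, rfl⟩, hψne y (hbc hy) hy0⟩, (hHs y hy0).symm⟩
  have hSB : strictTransform (Metric.ball (0 : F) R) = closure D := rfl
  set Q := Function.invFunOn H K with hQ
  have hQH : ∀ p ∈ K, Q (H p) = p := fun p hp => hinj.leftInvOn_invFunOn hp
  refine ⟨hφ0, ?_, hφ, ⟨ψ, ⟨?_, ?_⟩, hψ.mono hbc⟩, Q, ?_, ?_, ⟨H, ⟨?_, ?_⟩, ?_⟩, ?_⟩
  · refine ⟨?_, ?_, ?_⟩
    · rintro _ ⟨y, hy, rfl⟩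
      rwa [hφψ y (hbc hy)]
    · rintro _ ⟨y, hy, rfl⟩ _ ⟨z, hz, rfl⟩ h
      rw [hφψ y (hbc hy), hφψ z (hbc hz)] at h
      rw [h]
    · intro y hy
      exact ⟨ψ y, ⟨y, hy, rfl⟩, hφψ y (hbc hy)⟩
  · rintro _ ⟨y, hy, rfl⟩
    rw [hφψ y (hbc hy)]
  · intro y hy
    exact hφψ y (hbc hy)
  · rw [hST, hSB]
    refine ⟨?_, ?_, ?_⟩
    · rintro _ ⟨p, hp, rfl⟩
      rwa [hQH p (hcDK hp)]
    · rintro _ ⟨p, hp, rfl⟩ _ ⟨q, hq, rfl⟩ h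
      rw [hQH p (hcDK hp), hQH q (hcDK hq)] at h
      rw [h]
    · intro p hp
      exact ⟨H p, ⟨p, hp, rfl⟩, hQH p (hcDK hp)⟩
  · rw [hST]
    exact invFunOn_contOn hcDc (hHc.mono hcDK) (fun p hp => hQH p (hcDK hp))
  · rw [hST]
    rintro _ ⟨p, hp, rfl⟩
    rw [hQH p (hcDK hp)]
  · intro p hp
    exact hQH p (hcDK hp)
  · exact hHc.mono hcDK
  · rintro _ ⟨⟨y, hy, rfl⟩, hy0⟩
    have : y ≠ 0 := by
      rintro rfl
      exact hy0 hψ0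
    rw [← hHs y this, hφψ y (hbc hy)]
    exact hQH _ (hDK ⟨y, ⟨hy, this⟩, rfl⟩)

theorem dirA {n : ℕ} (X : Set (EuclideanSpace ℝ (Fin n)))
    (h0X : (0 : EuclideanSpace ℝ (Fin n)) ∈ X) (h : IsC1RegularAtZero X) :
    BlowSphericalRegularAtZero X := by
  obtain ⟨U, hUo, h0U, d, hS⟩ := h
  obtain ⟨W, Φ, hWo, h0W, hΦWo, hΦ, ⟨Ψ, ⟨hΨΦ, hΦΨ⟩, hΨ⟩, himg⟩ := hS 0 ⟨h0X, h0U⟩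
  set e := min d n with he
  have hen : e ≤ n := min_le_right _ _
  let πl : EuclideanSpace ℝ (Fin n) →ₗ[ℝ] EuclideanSpace ℝ (Fin e) :=
    { toFun := fun x => WithLp.toLp 2 (fun j => x (Fin.castLE hen j))
      map_add' := fun x y => by ext j; simp
      map_smul' := fun c x => by ext j; simp }
  let ιl : EuclideanSpace ℝ (Fin e) →ₗ[ℝ] EuclideanSpace ℝ (Fin n) :=
    { toFun := fun y => WithLp.toLp 2 (fun i => if h : (i : ℕ) < e then y ⟨i, h⟩ else 0)
      map_add' := fun x y => by
        ext j
        by_cases h : (j : ℕ) < e <;> simp [h]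
      map_smul' := fun c x => by
        ext j
        by_cases h : (j : ℕ) < e <;> simp [h] }
  let π := LinearMap.toContinuousLinearMap πl
  let ι := LinearMap.toContinuousLinearMap ιl
  have hπι : ∀ y, π (ι y) = y := by
    intro y
    ext j
    simp [π, ι, πl, ιl]
  have hιπ : ∀ x : EuclideanSpace ℝ (Fin n), (∀ i : Fin n, d ≤ (i : ℕ) → x i = 0) → ι (π x) = x := by
    intro x hx
    ext i
    by_cases h : (i : ℕ) < e
    · simp [π, ι, πl, ιl, h]
    · have : x i = 0 := hx i (by
        have := i.2
        omega)
      simp [π, ι, πl, ιl, h, this]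
  have hιz : ∀ y, ∀ i : Fin n, d ≤ (i : ℕ) → ι y i = 0 := by
    intro y i hi
    have : ¬ ((i : ℕ) < e) := by omega
    simp [ι, ιl, this]
  have hmemS : ∀ x ∈ (X ∩ U) ∩ W, ∀ i : Fin n, d ≤ (i : ℕ) → Φ x i = 0 := by
    intro x hx
    have : Φ x ∈ Φ '' W ∩ {x | ∀ i : Fin n, d ≤ (i : ℕ) → x i = 0} := himg ▸ ⟨x, hx, rfl⟩
    exact this.2
  have hΦ0z := hmemS 0 ⟨⟨h0X, h0U⟩, h0W⟩
  set ψ : EuclideanSpace ℝ (Fin e) → EuclideanSpace ℝ (Fin n) := fun y => Ψ (Φ 0 + ι y) with hψ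
  set φ : EuclideanSpace ℝ (Fin n) → EuclideanSpace ℝ (Fin e) := fun x => π (Φ x - Φ 0) with hφ
  have hcont : Continuous (fun y => Φ 0 + ι y) := by fun_prop
  have hpre : (fun y => Φ 0 + ι y) ⁻¹' (Φ '' W) ∈ 𝓝 (0 : EuclideanSpace ℝ (Fin e)) := by
    apply hcont.continuousAt.preimage_mem_nhds
    simp only [map_zero, add_zero]
    exact hΦWo.mem_nhds ⟨0, h0W, rfl⟩
  obtain ⟨R, hR, hRsub⟩ := Metric.nhds_basis_closedBall.mem_iff.1 hpre
  have hψmem : ∀ y ∈ Metric.closedBall (0 : EuclideanSpace ℝ (Fin e)) R, ψ y ∈ (X ∩ U) ∩ W := by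
    intro y hy
    have h1 : Φ 0 + ι y ∈ Φ '' ((X ∩ U) ∩ W) := by
      rw [himg]
      refine ⟨hRsub hy, fun i hi => ?_⟩
      simp [hΦ0z i hi, hιz y i hi]
    obtain ⟨x, hx, hxe⟩ := h1
    simp only [hψ, ← hxe]
    rw [hΨΦ hx.2]
    exact hx
  have hφψ : ∀ y ∈ Metric.closedBall (0 : EuclideanSpace ℝ (Fin e)) R, φ (ψ y) = y := by
    intro y hy
    simp only [hφ, hψ]
    rw [hΦΨ (hRsub hy)]
    simp [hπι]
  have hψφ : ∀ x ∈ (X ∩ U) ∩ W, ψ (φ x) = x := by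
    intro x hx
    simp only [hφ, hψ]
    rw [hιπ _ (fun i hi => by simp [hΦ0z i hi, hmemS x hx i hi])]
    simp [hΨΦ hx.2]
  have hψ0 : ψ 0 = 0 := by
    simp only [hψ, map_zero, add_zero]
    exact hΨΦ h0W
  have hφW : ContinuousOn φ W := by
    have := hΦ.continuousOn
    simp only [hφ]
    fun_prop
  have hVo : IsOpen (W ∩ φ ⁻¹' Metric.ball 0 R) := hφW.isOpen_inter_preimage hWo Metric.isOpen_ball
  have himgψ : X ∩ (U ∩ (W ∩ φ ⁻¹' Metric.ball 0 R)) = ψ '' Metric.ball 0 R := by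
    ext x
    constructor
    · rintro ⟨hx, hxU, hxW, hxb⟩
      exact ⟨φ x, hxb, hψφ x ⟨⟨hx, hxU⟩, hxW⟩⟩
    · rintro ⟨y, hy, rfl⟩
      have hy' := Metric.ball_subset_closedBall hy
      obtain ⟨⟨h1, h2⟩, h3⟩ := hψmem y hy'
      refine ⟨h1, h2, h3, ?_⟩
      rw [mem_preimage]
      rwa [hφψ y hy']
  have hφ0 : φ 0 = 0 := by simp [hφ]
  have hΨd : DifferentiableAt ℝ Ψ (Φ 0 + ι 0) := by
    have : Φ 0 + ι 0 = Φ 0 := by simp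
    rw [this]
    exact (hΨ.contDiffAt (hΦWo.mem_nhds ⟨0, h0W, rfl⟩)).differentiableAt (by norm_num)
  have hψd : DifferentiableAt ℝ ψ 0 := by
    have h1 : DifferentiableAt ℝ (fun y => Φ 0 + ι y) 0 := by fun_prop
    exact DifferentiableAt.comp (g := Ψ) 0 hΨd h1
  have hφd : DifferentiableAt ℝ φ 0 := by
    have h1 : DifferentiableAt ℝ Φ 0 :=
      (hΦ.contDiffAt (hWo.mem_nhds h0W)).differentiableAt (by norm_num)
    exact π.differentiableAt.comp 0 (h1.sub_const _)
  have hBinj : Function.Injective (fderiv ℝ ψ 0) := by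
    have h1 : HasFDerivAt (φ ∘ ψ) ((fderiv ℝ φ 0).comp (fderiv ℝ ψ 0)) 0 := by
      apply HasFDerivAt.comp
      · rw [hψ0]; exact hφd.hasFDerivAt
      · exact hψd.hasFDerivAt
    have h2 : HasFDerivAt (φ ∘ ψ) (ContinuousLinearMap.id ℝ _) 0 := by
      apply (hasFDerivAt_id 0).congr_of_eventuallyEq
      filter_upwards [Metric.closedBall_mem_nhds _ hR] with y hy
      exact hφψ y hy
    have h3 := h1.unique h2
    intro a b hab
    have := congrArg (fderiv ℝ φ 0) hab
    have e1 := DFunLike.congr_fun h3 a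
    have e2 := DFunLike.congr_fun h3 b
    simp only [ContinuousLinearMap.comp_apply, ContinuousLinearMap.id_apply] at e1 e2
    rw [← e1, ← e2, this]
  refine ⟨U ∩ (W ∩ φ ⁻¹' Metric.ball 0 R), hUo.inter hVo, ⟨h0U, h0W, ?_⟩, e, R, hR, φ, ?_⟩
  · rw [mem_preimage]
    rw [hφ0]
    exact Metric.mem_ball_self hR
  · rw [himgψ]
    apply coreA ψ φ _ hψd.hasFDerivAt hψ0 hBinj R hR _ hφψ
    · rw [← himgψ]
      exact hφW.mono (fun x hx => hx.2.2.1)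
    · exact hΨ.continuousOn.comp hcont.continuousOn hRsub

theorem curveC1 {n : ℕ} (X : Set (EuclideanSpace ℝ (Fin n)))
    (σ : ℝ → EuclideanSpace ℝ (Fin n)) (a0 : EuclideanSpace ℝ (Fin n)) (ha0 : a0 ≠ 0)
    (hσ : ContDiffAt ℝ 1 σ 0) (hσd : HasDerivAt σ a0 0) (hσ0 : σ 0 = 0)
    (h1 : ∀ᶠ s in 𝓝 0, σ s ∈ X)
    (h2 : ∀ V ∈ 𝓝 (0 : ℝ), ∀ᶠ x in 𝓝 0, x ∈ X → ∃ s ∈ V, σ s = x) :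
    IsC1RegularAtZero X := by
  have hn : 0 < n := by
    rcases Nat.eq_zero_or_pos n with h | h
    · subst h
      exact absurd (Subsingleton.elim a0 0) ha0
    · exact h
  let i0 : Fin n := ⟨0, hn⟩
  let e0 : EuclideanSpace ℝ (Fin n) := EuclideanSpace.single i0 1
  have he0 : e0 ≠ 0 := by
    intro h
    have := congrArg (fun x : EuclideanSpace ℝ (Fin n) => x i0) h
    simp [e0] at this
  obtain ⟨T, hT⟩ := SeparatingDual.exists_continuousLinearEquiv_apply_eq (R := ℝ) he0 ha0
  let P : EuclideanSpace ℝ (Fin n) →L[ℝ] ℝ := EuclideanSpace.proj i0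
  have hP : ∀ x, P x = x i0 := fun x => rfl
  let F : EuclideanSpace ℝ (Fin n) → EuclideanSpace ℝ (Fin n) :=
    fun x => σ (P x) + (T x - P x • a0)
  have hF0 : F 0 = 0 := by simp [F, hσ0]
  have hFs : ∀ s : ℝ, F (s • e0) = σ s := by
    intro s
    simp [F, hT, hP, e0]
  have hFc : ContDiffAt ℝ 1 F 0 := by
    have a1 : ContDiffAt ℝ 1 (fun x => σ (P x)) 0 := by
      apply ContDiffAt.comp (g := σ) 0
      · simpa using hσ
      · exact P.contDiff.contDiffAt
    have a2 : ContDiffAt ℝ 1 (fun x => T x - P x • a0) 0 :=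
      (T.contDiff.contDiffAt).sub ((P.contDiff.contDiffAt).smul contDiffAt_const)
    exact a1.add a2
  have hFd : HasFDerivAt F (T : EuclideanSpace ℝ (Fin n) →L[ℝ] EuclideanSpace ℝ (Fin n)) 0 := by
    have a1 : HasFDerivAt (fun x => σ (P x)) (P.smulRight a0) 0 := by
      have b : HasDerivAt σ a0 (P 0) := by simpa using hσd
      have := b.hasFDerivAt.comp 0 P.hasFDerivAt
      refine this.congr_fderiv ?_
      ext x
      simp
    have a2 : HasFDerivAt (fun x => T x - P x • a0)
        ((T : EuclideanSpace ℝ (Fin n) →L[ℝ] EuclideanSpace ℝ (Fin n)) - P.smulRight a0) 0 :=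
      T.hasFDerivAt.sub (P.smulRight a0).hasFDerivAt
    refine (a1.add a2).congr_fderiv ?_
    simp
  let h := hFc.toOpenPartialHomeomorph F hFd one_ne_zero
  have hh : ∀ x, h x = F x := fun x => rfl
  have h0s : (0 : EuclideanSpace ℝ (Fin n)) ∈ h.source :=
    hFc.mem_toOpenPartialHomeomorph_source hFd one_ne_zero
  have h0t : (0 : EuclideanSpace ℝ (Fin n)) ∈ h.target := by
    have := h.map_source h0s
    rwa [hh, hF0] at this
  have hs0 : h.symm 0 = 0 := by
    have := h.left_inv h0s
    rwa [hh, hF0] at this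
  have hsc : ContDiffAt ℝ 1 h.symm 0 := by
    have := hFc.to_localInverse hFd one_ne_zero
    rw [hF0] at this
    exact this
  have hO : ∀ᶠ x in 𝓝 (0 : EuclideanSpace ℝ (Fin n)),
      ContDiffAt ℝ 1 F x ∧ σ (P x) ∈ X ∧ x ∈ h.source := by
    refine (hFc.eventually (by simp)).and (Eventually.and ?_ (h.open_source.mem_nhds h0s))
    have : Tendsto P (𝓝 0) (𝓝 0) := by simpa using P.continuous.tendsto 0
    exact this.eventually h1
  obtain ⟨O, hOsub, hOo, h0O⟩ := eventually_nhds_iff.1 hO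
  let V : Set ℝ := {s | s • e0 ∈ O}
  have hV : V ∈ 𝓝 (0 : ℝ) := by
    have : Continuous (fun s : ℝ => s • e0) := by fun_prop
    exact (hOo.preimage this).mem_nhds (by simpa using h0O)
  have hW : ∀ᶠ x in 𝓝 (0 : EuclideanSpace ℝ (Fin n)),
      x ∈ h.target ∧ h.symm x ∈ O ∧ ContDiffAt ℝ 1 h.symm x ∧ (x ∈ X → ∃ s ∈ V, σ s = x) := by
    refine (Eventually.and (h.open_target.mem_nhds h0t) (Eventually.and ?_
      ((hsc.eventually (by simp)).and (h2 V hV))))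
    apply hsc.continuousAt.preimage_mem_nhds
    rw [hs0]
    exact hOo.mem_nhds h0O
  obtain ⟨W, hWsub, hWo, h0W⟩ := eventually_nhds_iff.1 hW
  refine ⟨W, hWo, h0W, 1, fun p hp => ⟨W, h.symm, hWo, hp.2, ?_, ?_, ⟨F, ⟨?_, ?_⟩, ?_⟩, ?_⟩⟩
  · exact h.symm.isOpen_image_of_subset_source hWo (fun x hx => (hWsub x hx).1)
  · exact fun x hx => (hWsub x hx).2.2.1.contDiffWithinAt
  · intro x hx
    exact h.right_inv (hWsub x hx).1
  · rintro _ ⟨x, hx, rfl⟩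
    rw [← hh, h.right_inv (hWsub x hx).1]
  · rintro _ ⟨x, hx, rfl⟩
    exact (hOsub _ (hWsub x hx).2.1).1.contDiffWithinAt
  · ext y
    constructor
    · rintro ⟨x, ⟨⟨hxX, -⟩, hxW⟩, rfl⟩
      refine ⟨⟨x, hxW, rfl⟩, ?_⟩
      obtain ⟨s, hs, rfl⟩ := (hWsub x hxW).2.2.2 hxX
      have : h.symm (σ s) = s • e0 := by
        rw [← hFs, ← hh]
        exact h.left_inv (hOsub _ hs).2.2
      intro i hi
      rw [this]
      have : i ≠ i0 := by
        rintro rfl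
        simp [i0] at hi
      simp [e0, this]
    · rintro ⟨⟨x, hxW, rfl⟩, hy⟩
      refine ⟨x, ⟨⟨?_, hxW⟩, hxW⟩, rfl⟩
      set y := h.symm x with hyd
      have hye : y = (P y) • e0 := by
        ext i
        by_cases hi : i = i0
        · subst hi
          simp [e0, hP]
        · have : y i = 0 := hy i (by
            have : (i : ℕ) ≠ 0 := fun h => hi (Fin.ext h)
            omega)
          simp [e0, hi, this]
      have hx : x = F y := (h.right_inv (hWsub x hxW).1).symm
      rw [hx, hye, hFs]
      exact (hOsub y (hWsub x hxW).2.1).2.1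

theorem odd_root (k : ℕ) (hk : Odd k) :
    ∃ ρ : ℝ → ℝ, Continuous ρ ∧ (∀ s, ρ s ^ k = s) ∧ ∀ t, ρ (t ^ k) = t := by
  have hsm : StrictMono (fun t : ℝ => t ^ k) := hk.strictMono_pow
  have hsurj : Function.Surjective (fun t : ℝ => t ^ k) := by
    apply Continuous.surjective (by fun_prop)
    · exact tendsto_pow_atTop hk.pos.ne'
    · have h1 : Tendsto (fun t : ℝ => -((-t) ^ k)) atBot atBot :=
        tendsto_neg_atTop_atBot.comp ((tendsto_pow_atTop hk.pos.ne').comp tendsto_neg_atBot_atTop)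
      refine h1.congr (fun t => ?_)
      rw [hk.neg_pow, neg_neg]
  let f := hsm.orderIsoOfSurjective _ hsurj
  refine ⟨f.symm, f.symm.continuous, fun s => f.apply_symm_apply s, fun t => f.symm_apply_apply t⟩

theorem sigmaC1 {E : Type*} [NormedAddCommGroup E] [NormedSpace ℝ E] [CompleteSpace E]
    (k : ℕ) (hk : Odd k) (ρ : ℝ → ℝ) (hρc : Continuous ρ) (hρ : ∀ s, ρ s ^ k = s)
    (hρ' : ∀ t, ρ (t ^ k) = t)
    (a : ℝ → E) (ha : AnalyticAt ℝ a 0) :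
    ContDiffAt ℝ 1 (fun s => s • a (ρ s)) 0 ∧ HasDerivAt (fun s => s • a (ρ s)) (a 0) 0 := by
  have hk0 : k ≠ 0 := hk.pos.ne'
  have hkR : (k : ℝ) ≠ 0 := by exact_mod_cast hk0
  have hρ0 : ρ 0 = 0 := by
    have := hρ' 0
    rwa [zero_pow hk0] at this
  let f' : ℝ → E := fun s => a (ρ s) + (ρ s / k) • deriv a (ρ s)
  obtain ⟨O, hO, hOo, h0O⟩ := eventually_nhds_iff.1 ha.eventually_analyticAt
  have hder : ∀ s ∈ ρ ⁻¹' O, HasDerivAt (fun s => s • a (ρ s)) (f' s) s := by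
    intro s hs
    have has : AnalyticAt ℝ a (ρ s) := hO _ hs
    by_cases h0 : s = 0
    · subst h0
      simp only [f', hρ0, zero_div, zero_smul, add_zero]
      rw [hasDerivAt_iff_tendsto_slope]
      have h1 : Tendsto (fun s => a (ρ s)) (𝓝[≠] 0) (𝓝 (a 0)) := by
        have : ContinuousAt (fun s => a (ρ s)) 0 := by
          apply ContinuousAt.comp (g := a)
          · rw [hρ0]; exact ha.continuousAt
          · exact hρc.continuousAt
        have := this.tendsto.mono_left (nhdsWithin_le_nhds (s := {0}ᶜ))
        simpa [hρ0] using this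
      refine h1.congr' ?_
      filter_upwards [self_mem_nhdsWithin] with s hs
      have : s ≠ 0 := hs
      simp [slope, smul_smul, this]
    · have hρs : ρ s ≠ 0 := by
        intro h
        apply h0
        rw [← hρ s, h, zero_pow hk0]
      have h1 : HasDerivAt (fun t : ℝ => t ^ k) (k * ρ s ^ (k - 1)) (ρ s) := hasDerivAt_pow k (ρ s)
      have h2 : HasDerivAt ρ (k * ρ s ^ (k - 1))⁻¹ s :=
        HasDerivAt.of_local_left_inverse hρc.continuousAt h1
          (mul_ne_zero hkR (pow_ne_zero _ hρs)) (Eventually.of_forall hρ)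
      have h3 : HasDerivAt (fun s => a (ρ s)) ((k * ρ s ^ (k - 1))⁻¹ • deriv a (ρ s)) s :=
        HasDerivAt.scomp s has.differentiableAt.hasDerivAt h2
      have h4 := (hasDerivAt_id s).smul h3
      refine h4.congr_deriv ?_
      simp only [f', id, one_smul, smul_smul]
      rw [add_comm]
      congr 2
      have : s = ρ s ^ (k - 1) * ρ s := by
        rw [← pow_succ, Nat.sub_add_cancel hk.pos, hρ]
      have hp := pow_ne_zero (k - 1) hρs
      have key : ∀ q : ℝ, q ^ (k - 1) ≠ 0 → s = q ^ (k - 1) * q →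
          s * ((k : ℝ) * q ^ (k - 1))⁻¹ = q / k := by
        intro q hq hsq
        rw [hsq]
        field_simp
      exact key _ hp this
  have h0mem : (0 : ℝ) ∈ ρ ⁻¹' O := by simpa [hρ0] using h0O
  refine ⟨?_, ?_⟩
  · rw [contDiffAt_one_iff]
    refine ⟨fun s => ContinuousLinearMap.toSpanSingleton ℝ (f' s), ρ ⁻¹' O, (hOo.preimage hρc).mem_nhds h0mem, ?_, ?_⟩
    · have hf' : ContinuousOn f' (ρ ⁻¹' O) := by
        intro s hs
        have has : AnalyticAt ℝ a (ρ s) := hO _ hs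
        have c1 : ContinuousAt (fun s => a (ρ s)) s :=
          ContinuousAt.comp (g := a) has.continuousAt hρc.continuousAt
        have c2 : ContinuousAt (fun s => deriv a (ρ s)) s :=
          ContinuousAt.comp (g := deriv a) has.deriv.continuousAt hρc.continuousAt
        have c3 : ContinuousAt (fun s => ρ s / k) s := (hρc.div_const _).continuousAt
        exact (c1.add (c3.smul c2)).continuousWithinAt
      have : Continuous (fun e : E => ContinuousLinearMap.toSpanSingleton ℝ e) :=
        (ContinuousLinearMap.smulRightL ℝ ℝ E (1 : ℝ →L[ℝ] ℝ)).continuous.congr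
          (fun e => by ext; simp)
      exact this.comp_continuousOn hf'
    · intro s hs
      exact (hder s hs).hasFDerivAt
  · have := hder 0 h0mem
    simpa [f', hρ0] using this

theorem tang {E : Type*} [NormedAddCommGroup E] [NormedSpace ℝ E]
    (g : ℝ → E) (hg : AnalyticAt ℝ g 0) (hg0 : g 0 = 0) (hne : ¬ ∀ᶠ t in 𝓝 0, g t = 0) :
    ∃ v : E, Tendsto (fun t => sphBlowup (g t)) (𝓝[>] 0) (𝓝 (v, 0)) := by
  obtain ⟨k, a, ha, ha0, hga⟩ := hg.exists_eventuallyEq_pow_smul_nonzero_iff.2 hne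
  refine ⟨‖a 0‖⁻¹ • a 0, ?_⟩
  have hac : Tendsto a (𝓝[>] 0) (𝓝 (a 0)) := ha.continuousAt.tendsto.mono_left nhdsWithin_le_nhds
  have hgc : Tendsto g (𝓝[>] 0) (𝓝 0) := by
    have := hg.continuousAt.tendsto.mono_left (nhdsWithin_le_nhds (s := Ioi 0))
    rwa [hg0] at this
  refine Tendsto.prodMk_nhds ?_ (by simpa using hgc.norm)
  have h1 : Tendsto (fun t => ‖a t‖⁻¹ • a t) (𝓝[>] 0) (𝓝 (‖a 0‖⁻¹ • a 0)) :=
    (hac.norm.inv₀ (norm_ne_zero_iff.2 ha0)).smul hac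
  refine h1.congr' ?_
  filter_upwards [nhdsWithin_le_nhds hga, self_mem_nhdsWithin] with t ht htp
  have htp : 0 < t := htp
  have hp : 0 < t ^ k := pow_pos htp k
  rw [ht, sub_zero, norm_smul, Real.norm_eq_abs, abs_of_pos hp, smul_smul, mul_inv, mul_right_comm,
    inv_mul_cancel₀ hp.ne', one_mul]

theorem tangEven {E : Type*} [NormedAddCommGroup E] [NormedSpace ℝ E]
    (g : ℝ → E) (hg : AnalyticAt ℝ g 0) (hg0 : g 0 = 0) (k : ℕ) (hk : Even k)
    (a : ℝ → E) (ha : AnalyticAt ℝ a 0) (ha0 : a 0 ≠ 0)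
    (hga : ∀ᶠ t in 𝓝 0, g t = t ^ k • a t) :
    ∃ v : E, Tendsto (fun t => sphBlowup (g t)) (𝓝[≠] 0) (𝓝 (v, 0)) := by
  refine ⟨‖a 0‖⁻¹ • a 0, ?_⟩
  have hac : Tendsto a (𝓝[≠] 0) (𝓝 (a 0)) := ha.continuousAt.tendsto.mono_left nhdsWithin_le_nhds
  have hgc : Tendsto g (𝓝[≠] 0) (𝓝 0) := by
    have := hg.continuousAt.tendsto.mono_left (nhdsWithin_le_nhds (s := {0}ᶜ))
    rwa [hg0] at this
  refine Tendsto.prodMk_nhds ?_ (by simpa using hgc.norm)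
  have h1 : Tendsto (fun t => ‖a t‖⁻¹ • a t) (𝓝[≠] 0) (𝓝 (‖a 0‖⁻¹ • a 0)) :=
    (hac.norm.inv₀ (norm_ne_zero_iff.2 ha0)).smul hac
  refine h1.congr' ?_
  filter_upwards [nhdsWithin_le_nhds hga, self_mem_nhdsWithin] with t ht htp
  have htp : t ≠ 0 := htp
  have hp : 0 < t ^ k := hk.pow_pos htp
  rw [ht, norm_smul, Real.norm_eq_abs, abs_of_pos hp, smul_smul, mul_inv, mul_right_comm,
    inv_mul_cancel₀ hp.ne', one_mul]

theorem bdUnique {E : Type*} [NormedAddCommGroup E] [NormedSpace ℝ E]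
    (g : ℝ → E) (hg0 : g 0 = 0) (ε : ℝ) (hε : 0 < ε) (δ : E → ℝ)
    (hδ : ContinuousOn δ (g '' Ioo (-ε) ε)) (hδg : ∀ t ∈ Ioo (-ε) ε, δ (g t) = t)
    (v : E) (hv : Tendsto (fun t => sphBlowup (g t)) (𝓝[>] 0) (𝓝 (v, 0)))
    (p : E × ℝ) (hp2 : p.2 = 0) (hp : p ∈ closure ((fun t => sphBlowup (g t)) '' Ioo 0 ε)) :
    p = (v, 0) := by
  rw [mem_closure_iff_clusterPt, ← Filter.map_principal, ClusterPt, inf_comm] at hp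
  have hp' : MapClusterPt p (𝓟 (Ioo 0 ε)) (fun t => sphBlowup (g t)) := by
    rw [MapClusterPt, ClusterPt, inf_comm]; exact hp
  rw [mapClusterPt_iff_ultrafilter] at hp'
  obtain ⟨F, hF, hFp⟩ := hp'
  have hmem : ∀ᶠ t in (F : Filter ℝ), t ∈ Ioo 0 ε := hF (mem_principal_self _)
  have h1 : Tendsto (fun t => ‖g t‖) F (𝓝 0) := by
    have := (continuous_snd.tendsto p).comp hFp
    rw [hp2] at this
    exact this
  have h2 : Tendsto g F (𝓝 0) := tendsto_zero_iff_norm_tendsto_zero.2 h1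
  have hsub : ∀ t ∈ Ioo 0 ε, t ∈ Ioo (-ε) ε := fun t ht => ⟨by linarith [ht.1], ht.2⟩
  have h0 : (0 : ℝ) ∈ Ioo (-ε) ε := ⟨by linarith, hε⟩
  have h3 : Tendsto g F (𝓝[g '' Ioo (-ε) ε] 0) := by
    rw [tendsto_nhdsWithin_iff]
    exact ⟨h2, hmem.mono fun t ht => ⟨t, hsub t ht, rfl⟩⟩
  have h4 := hδ 0 ⟨0, h0, hg0⟩
  have h5 : δ 0 = 0 := by
    have := hδg 0 h0
    rwa [hg0] at this
  have h6 : Tendsto (fun t => δ (g t)) F (𝓝 0) := by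
    have := h4.tendsto.comp h3
    rwa [h5] at this
  have h7 : Tendsto (fun t => t) (F : Filter ℝ) (𝓝 0) :=
    h6.congr' (hmem.mono fun t ht => hδg t (hsub t ht))
  have h8 : Tendsto (fun t => t) (F : Filter ℝ) (𝓝[>] 0) := by
    rw [tendsto_nhdsWithin_iff]
    exact ⟨h7, hmem.mono fun t ht => ht.1⟩
  exact tendsto_nhds_unique hFp (hv.comp h8)

theorem realInj (f : ℝ → ℝ) (η : ℝ) (hη : 0 < η) (hf : ContinuousOn f (Ioo (-η) η))
    (hi : InjOn f (Ioo (-η) η)) (h0 : f 0 = 0) :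
    f '' Ioo (-η) η ∈ 𝓝 (0 : ℝ) ∧
    (((∀ t ∈ Ioo 0 η, 0 < f t) ∧ (∀ t ∈ Ioo (-η) 0, f t < 0)) ∨
     ((∀ t ∈ Ioo 0 η, f t < 0) ∧ (∀ t ∈ Ioo (-η) 0, 0 < f t))) := by
  have m0 : (0 : ℝ) ∈ Ioo (-η) η := ⟨by linarith, hη⟩
  have m1 : -(η / 2) ∈ Ioo (-η) η := ⟨by linarith, by linarith⟩
  have m2 : η / 2 ∈ Ioo (-η) η := ⟨by linarith, by linarith⟩
  have hsub : Icc (-(η / 2)) (η / 2) ⊆ Ioo (-η) η := fun t ht =>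
    ⟨by linarith [ht.1], by linarith [ht.2]⟩
  have mp : ∀ t ∈ Ioo 0 η, t ∈ Ioo (-η) η := fun t ht => ⟨by linarith [ht.1], ht.2⟩
  have mn : ∀ t ∈ Ioo (-η) 0, t ∈ Ioo (-η) η := fun t ht => ⟨ht.1, by linarith [ht.2]⟩
  rcases hf.strictMonoOn_of_injOn_Ioo (by linarith) hi with h | h
  · refine ⟨?_, Or.inl ⟨fun t ht => ?_, fun t ht => ?_⟩⟩
    · have a1 := h m1 m0 (by linarith)
      have a2 := h m0 m2 (by linarith)
      rw [h0] at a1 a2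
      refine mem_of_superset (Icc_mem_nhds a1 a2) ?_
      exact (intermediate_value_Icc (by linarith) (hf.mono hsub)).trans (image_mono hsub)
    · rw [← h0]; exact h m0 (mp t ht) ht.1
    · rw [← h0]; exact h (mn t ht) m0 ht.2
  · refine ⟨?_, Or.inr ⟨fun t ht => ?_, fun t ht => ?_⟩⟩
    · have a1 := h m1 m0 (by linarith)
      have a2 := h m0 m2 (by linarith)
      rw [h0] at a1 a2
      refine mem_of_superset (Icc_mem_nhds a2 a1) ?_
      exact (intermediate_value_Icc' (by linarith) (hf.mono hsub)).trans (image_mono hsub)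
    · rw [← h0]; exact h m0 (mp t ht) ht.1
    · rw [← h0]; exact h (mn t ht) m0 ht.2

theorem dirB {n : ℕ} (X : Set (EuclideanSpace ℝ (Fin n)))
    (ε : ℝ) (hε : 0 < ε)
    (U : Set (EuclideanSpace ℝ (Fin n))) (hU : IsOpen U) (h0U : (0 : EuclideanSpace ℝ (Fin n)) ∈ U)
    (r : ℕ) (hr : 0 < r)
    (γ : Fin r → ℝ → EuclideanSpace ℝ (Fin n))
    (hγan : ∀ i, AnalyticOnNhd ℝ (γ i) (Set.Ioo (-ε) ε))
    (hγ0 : ∀ i, γ i 0 = 0)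
    (hinj : ∀ i, Set.InjOn (γ i) (Set.Ioo (-ε) ε))
    (hhomeo : ∀ i, ∃ δ : EuclideanSpace ℝ (Fin n) → ℝ,
      ContinuousOn δ (γ i '' Set.Ioo (-ε) ε) ∧ ∀ t ∈ Set.Ioo (-ε) ε, δ (γ i t) = t)
    (hij : ∀ i j, i ≠ j → (γ i '' Set.Ioo (-ε) ε) ∩ (γ j '' Set.Ioo (-ε) ε) = {0})
    (hdecomp : X ∩ U = ⋃ i, γ i '' Set.Ioo (-ε) ε)
    (hreg : BlowSphericalRegularAtZero X) : IsC1RegularAtZero X := by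
  obtain ⟨U', hU'o, h0U', d, R, hR, φ, hφ0, hbij, hφc, ⟨ψ, ⟨hψφ, hφψ⟩, hψc⟩, Φ, hΦbij, hΦc,
    ⟨Ψ, ⟨hΨΦ, hΦΨ⟩, hΨc⟩, hΦs⟩ := hreg
  have m0 : (0 : ℝ) ∈ Ioo (-ε) ε := ⟨by linarith, hε⟩
  have hI : Ioo (-ε) ε ∈ 𝓝 (0 : ℝ) := Ioo_mem_nhds m0.1 m0.2
  have hγnz : ∀ i, ∀ t ∈ Ioo (-ε) ε, t ≠ 0 → γ i t ≠ 0 := by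
    intro i t ht ht0 h
    exact ht0 (hinj i ht m0 (by rw [h, hγ0]))
  have hγX : ∀ i, ∀ t ∈ Ioo (-ε) ε, γ i t ∈ X ∩ U := by
    intro i t ht
    rw [hdecomp]
    exact mem_iUnion.2 ⟨i, t, ht, rfl⟩
  have hγan0 : ∀ i, AnalyticAt ℝ (γ i) 0 := fun i => hγan i 0 m0
  have hne : ∀ i, ¬ ∀ᶠ t in 𝓝 0, γ i t = 0 := by
    intro i h
    have h1 : ∀ᶠ t in 𝓝[≠] (0 : ℝ), γ i t = 0 ∧ t ∈ Ioo (-ε) ε :=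
      nhdsWithin_le_nhds (h.and hI)
    obtain ⟨t, ⟨h2, h3⟩, h4⟩ := (h1.and self_mem_nhdsWithin).exists
    exact hγnz i t h3 h4 h2
  have hγt : ∀ i, Tendsto (γ i) (𝓝 0) (𝓝 0) := by
    intro i
    have := (hγan0 i).continuousAt.tendsto
    rwa [hγ0] at this
  have hsmall : ∀ i, ∃ η > 0, η ≤ ε ∧ ∀ t ∈ Ioo (-η) η, γ i t ∈ U' := by
    intro i
    have h1 : γ i ⁻¹' U' ∈ 𝓝 (0 : ℝ) := hγt i (hU'o.mem_nhds h0U')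
    obtain ⟨η, hη, h2⟩ := Metric.mem_nhds_iff.1 h1
    refine ⟨min η ε, lt_min hη hε, min_le_right _ _, fun t ht => h2 ?_⟩
    rw [Metric.mem_ball, Real.dist_eq, sub_zero, abs_lt]
    have := min_le_left η ε
    exact ⟨by linarith [ht.1], by linarith [ht.2]⟩
  choose η hη hηε hηU using hsmall
  have hηsub : ∀ i, Ioo (-(η i)) (η i) ⊆ Ioo (-ε) ε := fun i t ht =>
    ⟨by linarith [ht.1, hηε i], by linarith [ht.2, hηε i]⟩
  have hmem : ∀ i, ∀ t ∈ Ioo (-(η i)) (η i), γ i t ∈ X ∩ U' := fun i t ht =>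
    ⟨(hγX i t (hηsub i ht)).1, hηU i t ht⟩
  -- finiteness of the boundary
  have hfin : {p | p ∈ strictTransform (X ∩ U') ∧ p.2 = 0}.Finite := by
    have hv1 := fun i => tang (γ i) (hγan0 i) (hγ0 i) (hne i)
    have hv2 : ∀ i, ∃ v, Tendsto (fun t => sphBlowup (γ i (-t))) (𝓝[>] 0) (𝓝 (v, 0)) := by
      intro i
      apply tang (fun t => γ i (-t))
      · have h1 : AnalyticAt ℝ (fun t : ℝ => -t) 0 := analyticAt_id.neg
        exact AnalyticAt.comp (g := γ i) (by simpa using hγan0 i) h1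
      · simp [hγ0]
      · intro h
        apply hne i
        have h2 : Tendsto (fun t : ℝ => -t) (𝓝 0) (𝓝 0) := by
          simpa using (continuous_neg (G := ℝ)).tendsto 0
        simpa using h2.eventually h
    choose v hv using hv1
    choose w hw using hv2
    refine ((finite_range (fun i => (v i, (0 : ℝ)))).union
      (finite_range (fun i => (w i, (0 : ℝ))))).subset ?_
    rintro p ⟨hp, hp2⟩
    obtain ⟨μ, hμ, hμU⟩ := Metric.mem_nhds_iff.1 (hU.mem_nhds h0U)
    have hop : IsOpen {q : EuclideanSpace ℝ (Fin n) × ℝ | q.2 < μ} :=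
      isOpen_lt continuous_snd continuous_const
    have h1 : p ∈ closure ({q : EuclideanSpace ℝ (Fin n) × ℝ | q.2 < μ} ∩
        sphBlowup '' ((X ∩ U') \ {0})) :=
      hop.inter_closure ⟨by simpa [hp2] using hμ, hp⟩
    have h2 : {q : EuclideanSpace ℝ (Fin n) × ℝ | q.2 < μ} ∩ sphBlowup '' ((X ∩ U') \ {0}) ⊆
        ⋃ i, ((fun t => sphBlowup (γ i t)) '' Ioo 0 ε ∪
          (fun t => sphBlowup (γ i (-t))) '' Ioo 0 ε) := by
      rintro _ ⟨hq, x, ⟨⟨hxX, -⟩, hx0⟩, rfl⟩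
      have hxU : x ∈ U := hμU (by simpa [sphBlowup] using hq)
      have hx : x ∈ ⋃ i, γ i '' Ioo (-ε) ε := hdecomp ▸ ⟨hxX, hxU⟩
      obtain ⟨i, t, ht, rfl⟩ := mem_iUnion.1 hx
      rw [mem_iUnion]
      refine ⟨i, ?_⟩
      rcases lt_trichotomy t 0 with h | h | h
      · exact Or.inr ⟨-t, ⟨by linarith, by linarith [ht.1]⟩, by simp⟩
      · subst h
        exact absurd (hγ0 i) hx0
      · exact Or.inl ⟨t, ⟨h, ht.2⟩, rfl⟩
    have h3 := closure_mono h2 h1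
    rw [closure_iUnion_of_finite] at h3
    obtain ⟨i, hi⟩ := mem_iUnion.1 h3
    rw [closure_union] at hi
    obtain ⟨δ, hδc, hδ⟩ := hhomeo i
    rcases hi with hi | hi
    · left
      exact ⟨i, (bdUnique (γ i) (hγ0 i) ε hε δ hδc hδ (v i) (hv i) p hp2 hi).symm⟩
    · right
      have himg : (fun t => γ i (-t)) '' Ioo (-ε) ε ⊆ γ i '' Ioo (-ε) ε := by
        rintro _ ⟨t, ht, rfl⟩
        exact ⟨-t, ⟨by linarith [ht.2], by linarith [ht.1]⟩, rfl⟩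
      refine ⟨i, (bdUnique (fun t => γ i (-t)) (by simp [hγ0]) ε hε (fun x => - δ x)
        (hδc.mono himg).neg (fun t ht => ?_) (w i) (hw i) p hp2 hi).symm⟩
      show - δ (γ i (-t)) = t
      rw [hδ (-t) ⟨by linarith [ht.2], by linarith [ht.1]⟩, neg_neg]
  -- the sphere is finite
  have hb0 : (0 : EuclideanSpace ℝ (Fin d)) ∈ Metric.ball (0 : EuclideanSpace ℝ (Fin d)) R :=
    Metric.mem_ball_self hR
  let i0 : Fin r := ⟨0, hr⟩
  have h0XU : (0 : EuclideanSpace ℝ (Fin n)) ∈ X ∩ U' := by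
    have := hmem i0 0 ⟨by linarith [hη i0], hη i0⟩
    rwa [hγ0] at this
  have hψ0 : ψ 0 = 0 := by
    have := hψφ h0XU
    rwa [hφ0] at this
  have hψm : ∀ y ∈ Metric.ball (0 : EuclideanSpace ℝ (Fin d)) R, ψ y ∈ X ∩ U' := by
    intro y hy
    obtain ⟨x, hx, rfl⟩ := hbij.surjOn hy
    rwa [hψφ hx]
  have hST : ∀ x ∈ X ∩ U', x ≠ 0 → sphBlowup x ∈ strictTransform (X ∩ U') := fun x hx hx0 =>
    subset_closure ⟨x, ⟨hx, hx0⟩, rfl⟩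
  have hΨs : ∀ y ∈ Metric.ball (0 : EuclideanSpace ℝ (Fin d)) R, y ≠ 0 →
      Ψ (sphBlowup y) = sphBlowup (ψ y) := by
    intro y hy hy0
    have hn0 : ψ y ≠ 0 := by
      intro h
      apply hy0
      rw [← hφψ hy, h, hφ0]
    have h1 := hΦs (ψ y) ⟨hψm y hy, hn0⟩
    rw [hφψ hy] at h1
    rw [← h1]
    exact hΨΦ (hST _ (hψm y hy) hn0)
  have hsph : (Metric.sphere (0 : EuclideanSpace ℝ (Fin d)) 1).Finite := by
    have hkey : ∀ w ∈ Metric.sphere (0 : EuclideanSpace ℝ (Fin d)) 1,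
        (w, (0 : ℝ)) ∈ strictTransform (Metric.ball (0 : EuclideanSpace ℝ (Fin d)) R) ∧
        (Ψ (w, 0)).2 = 0 := by
      intro w hw
      have hw1 : ‖w‖ = 1 := by simpa using hw
      have hw0 : w ≠ 0 := by
        rintro rfl
        simp at hw1
      have hs : Tendsto (fun s : ℝ => s • w) (𝓝[>] 0) (𝓝 0) := by
        have : Continuous (fun s : ℝ => s • w) := by fun_prop
        have := (this.tendsto 0).mono_left (nhdsWithin_le_nhds (s := Ioi 0))
        simpa using this
      have hev : ∀ᶠ s in 𝓝[>] (0 : ℝ), s • w ∈ Metric.ball (0 : EuclideanSpace ℝ (Fin d)) R ∧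
          s • w ≠ 0 ∧ sphBlowup (s • w) = (w, s) := by
        filter_upwards [hs (Metric.ball_mem_nhds _ hR), self_mem_nhdsWithin] with s h1 h2
        have h2 : 0 < s := h2
        refine ⟨h1, smul_ne_zero h2.ne' hw0, ?_⟩
        simp [sphBlowup, norm_smul, hw1, abs_of_pos h2, smul_smul, h2.ne']
      have ht : Tendsto (fun s : ℝ => sphBlowup (s • w)) (𝓝[>] 0) (𝓝 (w, 0)) := by
        have h1 : Continuous (fun s : ℝ => (w, s)) := by fun_prop
        have h2 := (h1.tendsto 0).mono_left (nhdsWithin_le_nhds (s := Ioi 0))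
        exact h2.congr' (hev.mono fun s hs => hs.2.2.symm)
      have hmemS : ∀ᶠ s in 𝓝[>] (0 : ℝ), sphBlowup (s • w) ∈
          strictTransform (Metric.ball (0 : EuclideanSpace ℝ (Fin d)) R) :=
        hev.mono fun s hs => subset_closure ⟨_, ⟨hs.1, hs.2.1⟩, rfl⟩
      have hwS : (w, (0 : ℝ)) ∈ strictTransform (Metric.ball (0 : EuclideanSpace ℝ (Fin d)) R) :=
        isClosed_closure.mem_of_tendsto ht hmemS
      refine ⟨hwS, ?_⟩
      have h1 := (hΨc _ hwS).tendsto.comp (tendsto_nhdsWithin_iff.2 ⟨ht, hmemS⟩)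
      have h2 := (continuous_snd.tendsto _).comp h1
      have h3 : Tendsto (fun s : ℝ => ‖ψ (s • w)‖) (𝓝[>] 0) (𝓝 0) := by
        have h4 := (hψc 0 hb0).tendsto.comp
          (tendsto_nhdsWithin_iff.2 ⟨hs, hev.mono fun s hs => hs.1⟩)
        have := h4.norm
        rw [hψ0, norm_zero] at this
        exact this
      refine tendsto_nhds_unique h2 (h3.congr' ?_)
      filter_upwards [hev] with s hs
      simp only [Function.comp]
      rw [hΨs _ hs.1 hs.2.1]
      rfl
    refine Finite.of_finite_image (f := fun w => Ψ (w, 0)) (hfin.subset ?_) ?_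
    · rintro _ ⟨w, hw, rfl⟩
      obtain ⟨h1, h2⟩ := hkey w hw
      refine ⟨?_, h2⟩
      obtain ⟨q, hq, he⟩ := hΦbij.surjOn h1
      show Ψ (w, 0) ∈ _
      rw [← he, hΨΦ hq]
      exact hq
    · intro w hw z hz h
      have h1 := hΦΨ (hkey w hw).1
      have h2 := hΦΨ (hkey z hz).1
      have h : Ψ (w, 0) = Ψ (z, 0) := h
      rw [h, h2] at h1
      simpa using h1.symm
  have hd1 : d = 1 := by
    rcases Nat.lt_trichotomy d 1 with h | h | h
    · exfalso
      have hd : d = 0 := by omega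
      subst hd
      have h1 : η i0 / 2 ∈ Ioo (-(η i0)) (η i0) := ⟨by linarith [hη i0], by linarith [hη i0]⟩
      exact hγnz i0 _ (hηsub i0 h1) (by linarith [hη i0])
        (hbij.injOn (hmem i0 _ h1) h0XU (Subsingleton.elim _ _))
    · exact h
    · exfalso
      have hrank : 1 < Module.rank ℝ (EuclideanSpace ℝ (Fin d)) := by
        rw [← Module.finrank_eq_rank, finrank_euclideanSpace_fin]
        exact_mod_cast h
      have h1 := isPreconnected_sphere hrank (0 : EuclideanSpace ℝ (Fin d)) 1
      refine h1.infinite_of_nontrivial ?_ hsph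
      let j : Fin d := ⟨0, by omega⟩
      refine ⟨EuclideanSpace.single j 1, by simp, - EuclideanSpace.single j 1, by simp, ?_⟩
      intro h2
      have := congrArg (fun x : EuclideanSpace ℝ (Fin d) => x j) h2
      simp at this
      linarith
  subst hd1
  let f : Fin r → ℝ → ℝ := fun i t => φ (γ i t) 0
  have hext : ∀ x y : EuclideanSpace ℝ (Fin 1), x 0 = y 0 → x = y := by
    intro x y h
    ext j
    rw [Subsingleton.elim j 0]
    exact h
  have hf0 : ∀ i, f i 0 = 0 := by
    intro i
    simp [f, hγ0, hφ0]
  have hfc : ∀ i, ContinuousOn (f i) (Ioo (-(η i)) (η i)) := by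
    intro i
    have h1 : ContinuousOn (fun t => φ (γ i t)) (Ioo (-(η i)) (η i)) :=
      hφc.comp ((hγan i).continuousOn.mono (hηsub i)) (fun t ht => hmem i t ht)
    have h2 : Continuous (fun x : EuclideanSpace ℝ (Fin 1) => x 0) := by fun_prop
    exact h2.comp_continuousOn h1
  have hfi : ∀ i, InjOn (f i) (Ioo (-(η i)) (η i)) := by
    intro i t ht s hs h
    exact hinj i (hηsub i ht) (hηsub i hs) (hbij.injOn (hmem i t ht) (hmem i s hs) (hext _ _ h))
  have hreal := fun i => realInj (f i) (η i) (hη i) (hfc i) (hfi i) (hf0 i)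
  have hone : ∀ i j : Fin r, i = j := by
    intro i j
    by_contra hne'
    have hIj : Ioo (-(η j)) (η j) ∈ 𝓝 (0 : ℝ) := Ioo_mem_nhds (by linarith [hη j]) (hη j)
    have h1 : Tendsto (f j) (𝓝 0) (𝓝 0) := by
      have := ((hfc j).continuousAt hIj).tendsto
      rwa [hf0] at this
    have h2 : ∀ᶠ t in 𝓝[≠] (0 : ℝ), f j t ∈ f i '' Ioo (-(η i)) (η i) ∧ t ∈ Ioo (-(η j)) (η j) :=
      nhdsWithin_le_nhds ((h1.eventually (hreal i).1).and hIj)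
    obtain ⟨t, ⟨⟨s, hs, hst⟩, ht⟩, ht0⟩ := (h2.and self_mem_nhdsWithin).exists
    have h3 : γ i s = γ j t := hbij.injOn (hmem i s hs) (hmem j t ht) (hext _ _ hst)
    have h4 : γ j t ∈ (γ i '' Set.Ioo (-ε) ε) ∩ (γ j '' Set.Ioo (-ε) ε) :=
      ⟨⟨s, hηsub i hs, h3⟩, ⟨t, hηsub j ht, rfl⟩⟩
    rw [hij i j hne'] at h4
    exact hγnz j t (hηsub j ht) ht0 h4
  obtain ⟨k, a, ha, ha0, hga⟩ :=
    (hγan0 i0).exists_eventuallyEq_pow_smul_nonzero_iff.2 (hne i0)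
  simp only [sub_zero] at hga
  have hodd : Odd k := by
    rw [← Nat.not_even_iff_odd]
    intro heven
    obtain ⟨v, hv⟩ := tangEven (γ i0) (hγan0 i0) (hγ0 i0) k heven a ha ha0 hga
    have hIη : Ioo (-(η i0)) (η i0) ∈ 𝓝 (0 : ℝ) := Ioo_mem_nhds (by linarith [hη i0]) (hη i0)
    have hev : ∀ᶠ t in 𝓝[≠] (0 : ℝ), t ∈ Ioo (-(η i0)) (η i0) ∧ t ≠ 0 :=
      (nhdsWithin_le_nhds hIη : _ ∈ 𝓝[≠] (0 : ℝ)) |> fun h => Eventually.and h self_mem_nhdsWithin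
    have hevS : ∀ᶠ t in 𝓝[≠] (0 : ℝ), sphBlowup (γ i0 t) ∈ strictTransform (X ∩ U') :=
      hev.mono fun t ht => hST _ (hmem i0 t ht.1) (hγnz i0 t (hηsub i0 ht.1) ht.2)
    have hvS : (v, (0 : ℝ)) ∈ strictTransform (X ∩ U') :=
      isClosed_closure.mem_of_tendsto hv hevS
    have h1 := (hΦc _ hvS).tendsto.comp (tendsto_nhdsWithin_iff.2 ⟨hv, hevS⟩)
    have hc : Continuous (fun q : EuclideanSpace ℝ (Fin 1) × ℝ => q.1 0) := by fun_prop
    have h2 := (hc.tendsto _).comp h1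
    have h3 : Tendsto (fun t => |f i0 t|⁻¹ * f i0 t) (𝓝[≠] 0) (𝓝 ((Φ (v, 0)).1 0)) := by
      refine h2.congr' ?_
      filter_upwards [hev] with t ht
      simp only [Function.comp]
      rw [hΦs _ ⟨hmem i0 t ht.1, hγnz i0 t (hηsub i0 ht.1) ht.2⟩]
      simp [sphBlowup, f, EuclideanSpace.norm_eq, Real.sqrt_sq_eq_abs]
    have hp : ∀ᶠ t in 𝓝[>] (0 : ℝ), t ∈ Ioo 0 (η i0) := Ioo_mem_nhdsGT (hη i0)
    have hn : ∀ᶠ t in 𝓝[<] (0 : ℝ), t ∈ Ioo (-(η i0)) 0 :=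
      Ioo_mem_nhdsLT (by linarith [hη i0])
    have h4 := h3.mono_left (nhdsWithin_mono (0 : ℝ) (fun t (ht : t ∈ Ioi (0 : ℝ)) => ne_of_gt ht))
    have h5 := h3.mono_left (nhdsWithin_mono (0 : ℝ) (fun t (ht : t ∈ Iio (0 : ℝ)) => ne_of_lt ht))
    have epos : ∀ c : ℝ, 0 < c → |c|⁻¹ * c = 1 := by
      intro c hc
      rw [abs_of_pos hc, inv_mul_cancel₀ hc.ne']
    have eneg : ∀ c : ℝ, c < 0 → |c|⁻¹ * c = -1 := by
      intro c hc
      rw [abs_of_neg hc, inv_neg, neg_mul, inv_mul_cancel₀ hc.ne]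
    rcases (hreal i0).2 with ⟨g1, g2⟩ | ⟨g1, g2⟩
    · have h6 := tendsto_nhds_unique (tendsto_const_nhds (x := (1 : ℝ)))
        (h4.congr' (hp.mono fun t ht => epos _ (g1 t ht)))
      have h7 := tendsto_nhds_unique (tendsto_const_nhds (x := (-1 : ℝ)))
        (h5.congr' (hn.mono fun t ht => eneg _ (g2 t ht)))
      linarith
    · have h6 := tendsto_nhds_unique (tendsto_const_nhds (x := (-1 : ℝ)))
        (h4.congr' (hp.mono fun t ht => eneg _ (g1 t ht)))
      have h7 := tendsto_nhds_unique (tendsto_const_nhds (x := (1 : ℝ)))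
        (h5.congr' (hn.mono fun t ht => epos _ (g2 t ht)))
      linarith
  obtain ⟨ρ, hρc, hρ, hρ'⟩ := odd_root k hodd
  have hk0 : k ≠ 0 := hodd.pos.ne'
  have hρ0 : ρ 0 = 0 := by
    have := hρ' 0
    rwa [zero_pow hk0] at this
  obtain ⟨c1, c2⟩ := sigmaC1 k hodd ρ hρc hρ hρ' a ha
  refine curveC1 X (fun s => s • a (ρ s)) (a 0) ha0 c1 c2 (by simp) ?_ ?_
  · have h1 : Tendsto ρ (𝓝 0) (𝓝 0) := by
      have := hρc.tendsto 0
      rwa [hρ0] at this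
    filter_upwards [h1.eventually (hga.and hI)] with s hs
    have := hs.1
    rw [hρ] at this
    rw [← this]
    exact (hγX i0 _ hs.2).1
  · intro V hV
    obtain ⟨δ, hδc, hδ⟩ := hhomeo i0
    have hδ0 : δ 0 = 0 := by
      have := hδ 0 m0
      rwa [hγ0] at this
    have h1 : Tendsto δ (𝓝[γ i0 '' Ioo (-ε) ε] 0) (𝓝 0) := by
      have := (hδc 0 ⟨0, m0, hγ0 i0⟩).tendsto
      rwa [hδ0] at this
    have h2 : ∀ᶠ t in 𝓝 (0 : ℝ), t ^ k ∈ V ∧ γ i0 t = t ^ k • a t := by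
      refine Eventually.and ?_ hga
      have h3 : Tendsto (fun t : ℝ => t ^ k) (𝓝 0) (𝓝 0) := by
        have := (continuous_pow (M := ℝ) k).tendsto 0
        simpa [hk0] using this
      exact h3 hV
    have h4 := eventually_nhdsWithin_iff.1 (h1.eventually h2)
    filter_upwards [h4, hU.mem_nhds h0U] with x hx hxU hxX
    have hx' : x ∈ ⋃ i, γ i '' Ioo (-ε) ε := hdecomp ▸ ⟨hxX, hxU⟩
    obtain ⟨i, t, ht, rfl⟩ := mem_iUnion.1 hx'
    obtain rfl := hone i i0
    have h5 := hx ⟨t, ht, rfl⟩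
    rw [hδ t ht] at h5
    refine ⟨t ^ k, h5.1, ?_⟩
    simp only [hρ']
    exact h5.2.symm

/-- If `X` admits near `0` a decomposition into finitely many analytic
branches `Γ_i = γ_i((−ε,ε))`, pairwise meeting only at `0`, with `X ∩ U = Γ_1 ∪ ⋯ ∪ Γ_r`,
then `X` is blow-spherical regular at `0` if and only if `X` is `C¹` regular at `0`. -/
theorem stmt4 {n : ℕ} (X : Set (EuclideanSpace ℝ (Fin n))) (h0X : (0 : EuclideanSpace ℝ (Fin n)) ∈ X)
    (ε : ℝ) (hε : 0 < ε)
    (U : Set (EuclideanSpace ℝ (Fin n))) (hU : IsOpen U) (h0U : (0 : EuclideanSpace ℝ (Fin n)) ∈ U)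
    (r : ℕ) (hr : 0 < r)
    (γ : Fin r → ℝ → EuclideanSpace ℝ (Fin n))
    (hγan : ∀ i, AnalyticOnNhd ℝ (γ i) (Set.Ioo (-ε) ε))
    (hγ0 : ∀ i, γ i 0 = 0)
    (hγne : ∀ i, ¬ ∀ t ∈ Set.Ioo (-ε) ε, γ i t = 0)
    (hinj : ∀ i, Set.InjOn (γ i) (Set.Ioo (-ε) ε))
    (hhomeo : ∀ i, ∃ δ : EuclideanSpace ℝ (Fin n) → ℝ,
      ContinuousOn δ (γ i '' Set.Ioo (-ε) ε) ∧ ∀ t ∈ Set.Ioo (-ε) ε, δ (γ i t) = t)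
    (hij : ∀ i j, i ≠ j → (γ i '' Set.Ioo (-ε) ε) ∩ (γ j '' Set.Ioo (-ε) ε) = {0})
    (hdecomp : X ∩ U = ⋃ i, γ i '' Set.Ioo (-ε) ε) :
    BlowSphericalRegularAtZero X ↔ IsC1RegularAtZero X := by
  exact ⟨dirB X ε hε U hU h0U r hr γ hγan hγ0 hinj hhomeo hij hdecomp, dirA X h0X⟩
end
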